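/- arXiv:1708.06929 — 7 statements merged into one kernel-verified Lean document; each statement's English description precedes it below -/
import Mathlib

section
/- Let 𝒢 = (G, E) be a graph (E ⊆ [G]², the 2-element subsets of G) and let μ be an infinite cardinal. Suppose there are subsets A, B ⊆ G such that μ ≤ |A| < |B| and, for every y ∈ B, |N_𝒢(y) ∩ A| ≥ μ, where N_𝒢(y) = {x ∈ G : {x,y} ∈ E}. Then Col(𝒢) > μ. -/
open Cardinal

universe u

/-- The coloring number of a graph: the least cardinal `c` for which there exists a
well-ordering `r` of the vertices such that every vertex has fewer than `c` neighbors
preceding it in `r`. -/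
noncomputable def colNum {V : Type u} (G : SimpleGraph V) : Cardinal.{u} :=
  sInf {c : Cardinal.{u} | ∃ r : V → V → Prop, IsWellOrder V r ∧
    ∀ x : V, #{y : V // G.Adj x y ∧ r y x} < c}

theorem statement0 {V : Type u} (G : SimpleGraph V) (μ : Cardinal.{u})
    (hμ : ℵ₀ ≤ μ) (A B : Set V) (hμA : μ ≤ #A) (hAB : #A < #B)
    (hB : ∀ y ∈ B, μ ≤ #(↥(G.neighborSet y ∩ A))) :
    μ < colNum G := by
  have hne : {c : Cardinal.{u} | ∃ r : V → V → Prop, IsWellOrder V r ∧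
      ∀ x : V, #{y : V // G.Adj x y ∧ r y x} < c}.Nonempty := by
    refine ⟨Order.succ #V, WellOrderingRel, inferInstance, fun x => ?_⟩
    exact Order.lt_succ_of_le (Cardinal.mk_subtype_le _)
  obtain ⟨r, hr, hlt⟩ := csInf_mem hne
  by_contra hcon
  rw [not_lt] at hcon
  have hlt' : ∀ x : V, #{y : V // G.Adj x y ∧ r y x} < μ :=
    fun x => lt_of_lt_of_le (hlt x) hcon
  have key : ∀ y : B, ∃ a : A, G.Adj a y ∧ r y a := by
    rintro ⟨y, hy⟩
    by_contra hno
    have hsub : (G.neighborSet y ∩ A) ⊆ {z : V | G.Adj y z ∧ r z y} := by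
      rintro z ⟨hz, hzA⟩
      have hz' : G.Adj y z := hz
      refine ⟨hz', ?_⟩
      rcases trichotomous_of r z y with h | h | h
      · exact h
      · exact absurd h.symm hz'.ne
      · exact absurd ⟨⟨z, hzA⟩, hz'.symm, h⟩ hno
    exact absurd (lt_of_le_of_lt (Cardinal.mk_le_mk_of_subset hsub) (hlt' y))
      (not_lt.mpr (hB y hy))
  choose f hf using key
  have hinj : Function.Injective
      (fun y : B => (⟨f y, ⟨y.1, hf y⟩⟩ : Σ a : A, {y : V // G.Adj a y ∧ r y a})) := by
    intro y z h
    have := congrArg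
      (fun p : (Σ a : A, {y : V // G.Adj a y ∧ r y a}) => p.2.1) h
    exact Subtype.ext this
  have h1 : #B ≤ #A := by
    calc #B ≤ #(Σ a : A, {y : V // G.Adj a y ∧ r y a}) := Cardinal.mk_le_of_injective hinj
      _ = Cardinal.sum (fun a : A => #{y : V // G.Adj a y ∧ r y a}) := Cardinal.mk_sigma _
      _ ≤ Cardinal.sum (fun _ : A => μ) := Cardinal.sum_le_sum _ _ (fun a => (hlt' a).le)
      _ = #A * μ := Cardinal.sum_const' _ _
      _ ≤ #A * #A := mul_le_mul_right hμA _
      _ = #A := Cardinal.mul_eq_self (hμ.trans hμA)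
  exact absurd hAB (not_lt.mpr h1)
end

section
/- Let κ be a regular uncountable cardinal, let 𝒢 = (κ, E) be a graph on the vertex set κ, and let μ < κ be an infinite cardinal. Set S_μ(𝒢) := {α < κ : |N_𝒢(β) ∩ α| ≥ μ for some β ≥ α}. Then: (1) if S_μ(𝒢) is stationary in κ, then Col(𝒢) > μ; (2) if S_μ(𝒢) is non-stationary in κ and Col(𝒢_α) ≤ μ for every α < κ, then Col(𝒢) ≤ μ. -/
open Cardinal

/-- The coloring number of the graph with edge relation `E`, restricted to the vertex set `A`:
the least cardinal `c` for which there exists a well-ordering `r` of `A` such that every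
vertex has fewer than `c` neighbors preceding it in `r`. -/
noncomputable def colNumOn (E : Ordinal → Ordinal → Prop) (A : Set Ordinal) : Cardinal.{1} :=
  sInf {c : Cardinal.{1} | ∃ r : A → A → Prop, IsWellOrder A r ∧
    ∀ x : A, #{y : A // E ↑y ↑x ∧ r y x} < c}

/-- `C` is a club (closed and unbounded) subset of `δ`. -/
def IsClubIn (C : Set Ordinal) (δ : Ordinal) : Prop :=
  C ⊆ Set.Iio δ ∧ (∀ β < δ, ∃ γ ∈ C, β ≤ γ) ∧
    ∀ β < δ, 0 < β → sSup (C ∩ Set.Iio β) = β → β ∈ C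

/-- `S` is stationary in `δ`: it meets every club in `δ`. -/
def IsStationaryIn (S : Set Ordinal) (δ : Ordinal) : Prop :=
  ∀ C, IsClubIn C δ → (S ∩ C).Nonempty

theorem colNumOn_le_iff' (E : Ordinal.{0} → Ordinal.{0} → Prop) (A : Set Ordinal.{0})
    (c : Cardinal.{1}) :
    colNumOn E A ≤ c ↔ ∃ r : A → A → Prop, IsWellOrder A r ∧
      ∀ x : A, #{y : A // E ↑y ↑x ∧ r y x} < c := by
  constructor
  · intro h
    have hne : {c : Cardinal.{1} | ∃ r : A → A → Prop, IsWellOrder A r ∧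
        ∀ x : A, #{y : A // E ↑y ↑x ∧ r y x} < c}.Nonempty :=
      ⟨Order.succ #A, fun x y => x < y, inferInstance, fun x =>
        Order.lt_succ_of_le (mk_subtype_le _)⟩
    obtain ⟨r, hr, hx⟩ := csInf_mem hne
    exact ⟨r, hr, fun x => (hx x).trans_le h⟩
  · intro h
    exact csInf_le' h

theorem exists_bound_of_regular {κ : Cardinal.{0}} (hκ : κ.IsRegular) (s : Set Ordinal.{0})
    (hs : ∀ x ∈ s, x < κ.ord) (hc : #s < Cardinal.lift.{1} κ) :
    ∃ γ < κ.ord, ∀ x ∈ s, x < γ := by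
  refine ⟨sSup ((· + 1) '' s), Ordinal.sSup_add_one_lt_of_lt_cof ?_ hs, ?_⟩
  · rw [← Ordinal.lift_cof, hκ.cof_ord]
    exact hc
  · intro x hx
    refine (Order.lt_succ x).trans_le (le_csSup ⟨κ.ord, ?_⟩ ⟨x, hx, rfl⟩)
    rintro _ ⟨y, hy, rfl⟩
    exact Order.succ_le_of_lt (hs y hy)

theorem club_of_closure {κ : Cardinal.{0}} (hκ : κ.IsRegular) (hunc : ℵ₀ < κ)
    (f : Ordinal.{0} → Ordinal.{0}) (hf : ∀ β < κ.ord, f β < κ.ord) :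
    IsClubIn {α | α < κ.ord ∧ ∀ β < α, f β ≤ α} κ.ord := by
  refine ⟨fun α h => h.1, ?_, ?_⟩
  · have hg : ∀ α, ∃ γ, α < κ.ord → γ < κ.ord ∧ ∀ β < α, f β < γ := by
      intro α
      by_cases hα : α < κ.ord
      · obtain ⟨γ, h1, h2⟩ := exists_bound_of_regular hκ (f '' Set.Iio α) (by
          rintro _ ⟨y, hy, rfl⟩
          exact hf y (lt_trans hy hα)) (mk_image_le.trans_lt (by
            rw [Cardinal.mk_Iio_ordinal]
            exact Cardinal.lift_lt.2 (Cardinal.lt_ord.1 hα)))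
        exact ⟨γ, fun _ => ⟨h1, fun β hβ => h2 _ ⟨β, hβ, rfl⟩⟩⟩
      · exact ⟨0, fun h => absurd h hα⟩
    choose g hg using hg
    intro a ha
    have hlt : Ordinal.nfp g a < κ.ord :=
      Ordinal.nfp_lt_ord (by rwa [hκ.cof_ord]) (fun i hi => (hg i hi).1) ha
    refine ⟨Ordinal.nfp g a, ⟨hlt, ?_⟩, Ordinal.le_nfp g a⟩
    intro β hβ
    obtain ⟨n, hn⟩ := Ordinal.lt_nfp_iff.1 hβ
    have h1 : g^[n] a < κ.ord := (Ordinal.iterate_le_nfp g a n).trans_lt hlt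
    have h2 := (hg _ h1).2 β hn
    rw [← Function.iterate_succ_apply' g n a] at h2
    exact h2.le.trans (Ordinal.iterate_le_nfp g a _)
  · intro β hβ h0 hsup
    refine ⟨hβ, fun γ hγ => ?_⟩
    rw [← hsup] at hγ
    obtain ⟨c, ⟨hc, hcβ⟩, hγc⟩ := exists_lt_of_lt_csSup' hγ
    exact (hc.2 γ hγc).trans (le_of_lt hcβ)

theorem part1 (κ : Cardinal.{0}) (hκreg : κ.IsRegular) (hκunc : ℵ₀ < κ)
    (μ : Cardinal.{0}) (hμκ : μ < κ)
    (E : Ordinal.{0} → Ordinal.{0} → Prop) (hsym : Symmetric E) (hirr : ∀ α, ¬ E α α)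
    (hS : IsStationaryIn {α | α < κ.ord ∧ ∃ β, α ≤ β ∧ β < κ.ord ∧
        Cardinal.lift.{1} μ ≤ #{x : Ordinal // E x β ∧ x < α}} κ.ord) :
      Cardinal.lift.{1} μ < colNumOn E (Set.Iio κ.ord) := by
  by_contra hcon
  obtain ⟨r, hr, hx⟩ := (colNumOn_le_iff' _ _ _).1 (not_lt.1 hcon)
  have hf : ∀ β, ∃ γ, ∀ hβ : β < κ.ord, γ < κ.ord ∧
      ∀ y : Set.Iio κ.ord, E y β → r y ⟨β, hβ⟩ → (y : Ordinal) < γ := by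
    intro β
    by_cases hβ : β < κ.ord
    · obtain ⟨γ, h1, h2⟩ := exists_bound_of_regular hκreg
        (Subtype.val '' {y : Set.Iio κ.ord | E y β ∧ r y ⟨β, hβ⟩}) (by
          rintro _ ⟨y, hy, rfl⟩
          exact y.2) (mk_image_le.trans_lt ((hx ⟨β, hβ⟩).trans (Cardinal.lift_lt.2 hμκ)))
      exact ⟨γ, fun _ => ⟨h1, fun y hy hy' => h2 _ ⟨y, ⟨hy, hy'⟩, rfl⟩⟩⟩
    · exact ⟨0, fun h => absurd h hβ⟩
  choose f hf using hf
  obtain ⟨α, ⟨hα, β, hαβ, hβ, hcard⟩, -, hcl⟩ :=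
    hS _ (club_of_closure hκreg hκunc f fun β hβ => (hf β hβ).1)
  refine (hcard.trans ?_).not_gt (hx ⟨β, hβ⟩)
  have key : ∀ x : Ordinal, E x β → ∀ h : x < α, r ⟨x, h.trans hα⟩ ⟨β, hβ⟩ := by
    intro x hE h
    rcases trichotomous_of r ⟨x, h.trans hα⟩ ⟨β, hβ⟩ with h1 | h1 | h1
    · exact h1
    · have := congrArg Subtype.val h1
      simp only at this
      exact absurd hE (this ▸ hirr x)
    · have h2 := (hf x (h.trans hα)).2 ⟨β, hβ⟩ (hsym hE) h1
      exact absurd (h2.trans_le ((hcl x h).trans hαβ)) (lt_irrefl _)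
  refine mk_le_of_injective
    (f := fun x => ⟨⟨x.1, x.2.2.trans hα⟩, x.2.1, key x.1 x.2.1 x.2.2⟩) ?_
  intro x y hxy
  simpa [Subtype.ext_iff] using hxy

theorem part2 (κ : Cardinal.{0})
    (μ : Cardinal.{0}) (hμ : ℵ₀ ≤ μ)
    (E : Ordinal.{0} → Ordinal.{0} → Prop)
    (hS : ¬ IsStationaryIn {α | α < κ.ord ∧ ∃ β, α ≤ β ∧ β < κ.ord ∧
        Cardinal.lift.{1} μ ≤ #{x : Ordinal // E x β ∧ x < α}} κ.ord)
    (hcol : ∀ α < κ.ord, colNumOn E (Set.Iio α) ≤ Cardinal.lift.{1} μ)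
    (hlim : ∀ α < κ.ord, α + 1 < κ.ord) :
      colNumOn E (Set.Iio κ.ord) ≤ Cardinal.lift.{1} μ := by
  have hμ1 : ℵ₀ ≤ Cardinal.lift.{1} μ := aleph0_le_lift.2 hμ
  unfold IsStationaryIn at hS
  push Not at hS
  obtain ⟨C, ⟨hCsub, hCunb, hCcl⟩, hdis⟩ := hS
  -- `n x` is the least element of the club above `x`
  have hn : ∀ x : Set.Iio κ.ord, ∃ ν, ν ∈ C ∧ (x : Ordinal) < ν ∧
      ∀ c ∈ C, (x : Ordinal) < c → ν ≤ c := by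
    intro x
    have hne : {c | c ∈ C ∧ (x : Ordinal) < c}.Nonempty := by
      obtain ⟨γ, hγ, h⟩ := hCunb _ (hlim _ x.2)
      exact ⟨γ, hγ, (Order.lt_succ _).trans_le h⟩
    have := csInf_mem hne
    exact ⟨_, this.1, this.2, fun c hc hxc => csInf_le' ⟨hc, hxc⟩⟩
  choose n hnC hxn hnmin using hn
  have hr : ∀ ν : Set.Iio κ.ord, ∃ ρ : Ordinal.{0} → Ordinal.{1},
      Set.InjOn ρ (Set.Iio ν) ∧ ∀ x < (ν : Ordinal),
        #{y : Ordinal // E y x ∧ y < ν ∧ ρ y < ρ x} < Cardinal.lift.{1} μ := by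
    intro ν
    obtain ⟨r, hr, hx⟩ := (colNumOn_le_iff' _ _ _).1 (hcol ν.1 ν.2)
    classical
    refine ⟨fun x => if h : x < ν then Ordinal.typein r ⟨x, h⟩ else 0, ?_, ?_⟩
    · intro x (hxν : x < ν) y (hyν : y < ν) hxy
      simp only [hxν, hyν, dif_pos] at hxy
      exact congrArg Subtype.val (Ordinal.typein_injective r hxy)
    · intro x hxν
      refine lt_of_le_of_lt ?_ (hx ⟨x, hxν⟩)
      refine mk_le_of_injective
        (f := fun y => ⟨⟨y.1, y.2.2.1⟩, y.2.1, ?_⟩) ?_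
      · have := y.2.2.2
        simp only [hxν, y.2.2.1, dif_pos] at this
        exact (Ordinal.typein_lt_typein r).1 this
      · intro x y hxy
        simpa [Subtype.ext_iff] using hxy
  choose ρ hρinj hρ using hr
  let N : Set.Iio κ.ord → Set.Iio κ.ord := fun x => ⟨n x, hCsub (hnC x)⟩
  let φ : Set.Iio κ.ord → Ordinal.{0} ×ₗ Ordinal.{1} := fun x => toLex (n x, ρ (N x) x)
  have hφ : Function.Injective φ := by
    intro x y hxy
    have h := toLex_inj.1 hxy
    rw [Prod.mk.injEq] at h
    have hN : N x = N y := Subtype.ext h.1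
    have h2 := h.2
    rw [hN] at h2
    refine Subtype.ext (hρinj (N y) ?_ ?_ h2)
    · exact (hxn x).trans_eq h.1
    · exact hxn y
  rw [colNumOn_le_iff']
  refine ⟨Order.Preimage φ (· < ·), (RelEmbedding.preimage ⟨φ, hφ⟩ (· < ·)).isWellOrder, ?_⟩
  intro x
  -- predecessors in earlier blocks
  have hA : #{y : Set.Iio κ.ord // E y x ∧ n y < n x} < Cardinal.lift.{1} μ := by
    by_cases hemp : ∃ y, n y < n x
    · obtain ⟨y0, hy0⟩ := hemp
      have hle : ∀ y, n y < n x → n y ≤ x := by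
        intro y hy
        by_contra h
        exact (hnmin x _ (hnC y) (not_le.1 h)).not_gt hy
      have hbdd : BddAbove (C ∩ Set.Iic (x : Ordinal)) := ⟨x, fun c hc => hc.2⟩
      have hne : (C ∩ Set.Iic (x : Ordinal)).Nonempty := ⟨n y0, hnC y0, hle y0 hy0⟩
      set α := sSup (C ∩ Set.Iic (x : Ordinal)) with hα
      have hαx : α ≤ x := csSup_le hne fun c hc => hc.2
      have hyα : ∀ y, n y < n x → (y : Ordinal) < α := fun y hy =>
        (hxn y).trans_le (le_csSup hbdd ⟨hnC y, hle y hy⟩)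
      have hακ : α < κ.ord := hαx.trans_lt x.2
      have hαC : α ∈ C := by
        by_contra hαn
        refine hαn (hCcl α hακ (bot_le.trans_lt (hyα y0 hy0)) ?_)
        have : C ∩ Set.Iio α = C ∩ Set.Iic (x : Ordinal) := by
          ext c
          constructor
          · rintro ⟨h1, h2⟩
            exact ⟨h1, (le_of_lt h2).trans hαx⟩
          · rintro ⟨h1, h2⟩
            refine ⟨h1, lt_of_le_of_ne (le_csSup hbdd ⟨h1, h2⟩) ?_⟩
            rintro rfl
            exact hαn h1
        rw [this]
      have hlt : #{z : Ordinal // E z x ∧ z < α} < Cardinal.lift.{1} μ := by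
        by_contra h
        have : α ∈ (∅ : Set Ordinal) := hdis ▸ ⟨⟨hακ, x, hαx, x.2, not_lt.1 h⟩, hαC⟩
        exact this
      refine lt_of_le_of_lt (mk_le_of_injective
        (f := fun y => ⟨y.1.1, y.2.1, hyα y.1 y.2.2⟩) ?_) hlt
      intro y z hyz
      simpa [Subtype.ext_iff] using hyz
    · have : IsEmpty {y : Set.Iio κ.ord // E y x ∧ n y < n x} :=
        ⟨fun y => hemp ⟨y.1, y.2.2⟩⟩
      rw [mk_eq_zero]
      exact aleph0_pos.trans_le hμ1
  have hB : #{y : Set.Iio κ.ord // E y x ∧ (y : Ordinal) < n x ∧ ρ (N x) y < ρ (N x) x}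
      < Cardinal.lift.{1} μ := by
    refine lt_of_le_of_lt (mk_le_of_injective (f := fun y => ⟨y.1.1, y.2⟩) ?_)
      (hρ (N x) x (hxn x))
    intro y z hyz
    simpa [Subtype.ext_iff] using hyz
  refine lt_of_le_of_lt ?_ (add_lt_of_lt hμ1 hA hB)
  refine le_trans (mk_le_mk_of_subset (s := {y : Set.Iio κ.ord | E y x ∧ φ y < φ x})
    (t := {y : Set.Iio κ.ord | E y x ∧ n y < n x} ∪
      {y : Set.Iio κ.ord | E y x ∧ (y : Ordinal) < n x ∧ ρ (N x) y < ρ (N x) x}) ?_)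
    (mk_union_le _ _)
  rintro y ⟨hE, hlt⟩
  rcases Prod.Lex.toLex_lt_toLex.1 hlt with h | ⟨h1, h2⟩
  · exact Or.inl ⟨hE, h⟩
  · simp only at h1 h2
    have hN : N y = N x := Subtype.ext h1
    rw [hN] at h2
    exact Or.inr ⟨hE, h1 ▸ hxn y, h2⟩

theorem statement1 (κ : Cardinal.{0}) (hκreg : κ.IsRegular) (hκunc : ℵ₀ < κ)
    (μ : Cardinal.{0}) (hμ : ℵ₀ ≤ μ) (hμκ : μ < κ)
    (E : Ordinal → Ordinal → Prop) (hsym : Symmetric E) (hirr : ∀ α, ¬ E α α) :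
    (IsStationaryIn {α | α < κ.ord ∧ ∃ β, α ≤ β ∧ β < κ.ord ∧
        Cardinal.lift.{1} μ ≤ #{x : Ordinal // E x β ∧ x < α}} κ.ord →
      Cardinal.lift.{1} μ < colNumOn E (Set.Iio κ.ord)) ∧
    ((¬ IsStationaryIn {α | α < κ.ord ∧ ∃ β, α ≤ β ∧ β < κ.ord ∧
        Cardinal.lift.{1} μ ≤ #{x : Ordinal // E x β ∧ x < α}} κ.ord) →
      (∀ α < κ.ord, colNumOn E (Set.Iio α) ≤ Cardinal.lift.{1} μ) →
      colNumOn E (Set.Iio κ.ord) ≤ Cardinal.lift.{1} μ) := by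
  refine ⟨part1 κ hκreg hκunc μ hμκ E hsym hirr, fun h1 h2 => part2 κ μ hμ E h1 h2 ?_⟩
  intro α hα
  exact (Cardinal.isSuccLimit_ord hκreg.aleph0_le).succ_lt hα
end

section
/- Suppose μ and κ are infinite cardinals such that κ is regular and κ is not the successor of a singular cardinal of cofinality cf(μ). If 𝒢 = (κ, E) is a graph on the vertex set κ and Col(𝒢_α) ≤ μ for every α < κ, then Col(𝒢) ≤ μ⁺. -/
open Cardinal

open Set

lemma aux_get_h {E : Ordinal.{0} → Ordinal.{0} → Prop} {A : Set Ordinal.{0}} {c : Cardinal.{1}}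
    (hc : colNumOn E A ≤ c) : ∃ h : Ordinal.{0} → Ordinal.{1}, InjOn h A ∧
      ∀ x ∈ A, #{y | y ∈ A ∧ E y x ∧ h y < h x} < c := by
  classical
  have hne : {c : Cardinal.{1} | ∃ r : A → A → Prop, IsWellOrder A r ∧
    ∀ x : A, #{y : A // E ↑y ↑x ∧ r y x} < c}.Nonempty := by
    refine ⟨Order.succ #A, (· < ·), inferInstance, fun x => ?_⟩
    exact Order.lt_succ_of_le (mk_subtype_le _)
  obtain ⟨r, hr, h⟩ := csInf_mem hne
  refine ⟨fun x => if hx : x ∈ A then Ordinal.typein r ⟨x, hx⟩ else 0, ?_, ?_⟩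
  · intro x hx y hy hxy
    simp only [hx, hy, dif_pos] at hxy
    simpa using hxy
  · intro x hx
    refine lt_of_le_of_lt ?_ ((h ⟨x, hx⟩).trans_le hc)
    refine mk_le_of_injective (f := fun y => ⟨⟨y.1, y.2.1⟩, y.2.2.1, ?_⟩) ?_
    · have := y.2.2.2
      have hy := y.2.1
      simp only [hx, hy, dif_pos] at this
      simpa using this
    · intro y z hyz
      simpa [Subtype.ext_iff] using hyz

lemma aux_of_h {E : Ordinal.{0} → Ordinal.{0} → Prop} {A : Set Ordinal.{0}} {c : Cardinal.{1}}
    {γ : Type*} [LinearOrder γ] [WellFoundedLT γ] (f : Ordinal.{0} → γ) (hf : InjOn f A)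
    (h : ∀ x ∈ A, #{y | y ∈ A ∧ E y x ∧ f y < f x} < c) : colNumOn E A ≤ c := by
  refine csInf_le' ⟨fun x y => f x < f y, ?_, ?_⟩
  · let g : A ↪ γ := ⟨fun x => f x, fun x y hxy => Subtype.ext (hf x.2 y.2 hxy)⟩
    exact (RelEmbedding.preimage g (· < ·)).isWellOrder
  · intro x
    refine lt_of_le_of_lt ?_ (h x x.2)
    refine mk_le_of_injective (f := fun y => ⟨y.1.1, y.1.2, y.2.1, y.2.2⟩) ?_
    intro y z hyz
    simpa [Subtype.ext_iff] using hyz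

lemma aux_type_le {α : Type*} [LinearOrder α] [WellFoundedLT α] (M : Cardinal)
    (h : ∀ x : α, #(Iio x) < M) : Ordinal.type (α := α) (· < ·) ≤ M.ord := by
  by_contra! hlt
  obtain ⟨x, hx⟩ := Ordinal.typein_surj (α := α) (· < ·) hlt
  have h2 := Ordinal.card_typein (r := ((· < ·) : α → α → Prop)) x
  rw [hx, card_ord] at h2
  exact absurd (h x) (by rw [h2]; exact lt_irrefl _)

lemma aux_card_le {α : Type*} [LinearOrder α] [WellFoundedLT α] (M : Cardinal)
    (h : ∀ x : α, #(Iio x) < M) : #α ≤ M := by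
  have := Ordinal.card_le_card (aux_type_le M h)
  simpa using this

lemma aux_Iio_sub {α : Type*} [LinearOrder α] (X : Set α) (x : X) :
    #(Iio x) ≤ #(X ∩ Iio x.1 : Set α) := by
  refine mk_le_of_injective (f := fun y => ⟨y.1.1, y.1.2, y.2⟩) ?_
  intro y z hyz
  simpa [Subtype.ext_iff] using hyz

lemma aux_cof {α : Type*} [LinearOrder α] [WellFoundedLT α] (M : Cardinal) (X : Set α)
    (h : ∀ x : α, #(X ∩ Iio x : Set α) < M) (hX : M ≤ #X) : Order.cof α = M.ord.cof := by
  have hc : IsCofinal X := by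
    intro a
    by_contra! hb
    have : X ∩ Iio a = X := inter_eq_left.2 fun x hx => hb x hx
    have h2 := h a
    rw [this] at h2
    exact absurd hX (not_le.2 h2)
  have h1 : Ordinal.type (α := X) (· < ·) ≤ M.ord :=
    aux_type_le M fun x => (aux_Iio_sub X x).trans_lt (h x)
  have h2 : M.ord ≤ Ordinal.type (α := X) (· < ·) :=
    (ord_le_ord.2 hX).trans (ord_le_type _)
  rw [← Order.cof_eq_of_isCofinal hc, ← Ordinal.cof_type, le_antisymm h1 h2]

/-- counting lemma -/
lemma aux_count {E : Ordinal.{0} → Ordinal.{0} → Prop} (hsym : Symmetric E) (hirr : ∀ α, ¬ E α α)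
    {G A B : Set Ordinal.{0}} {M N : Cardinal.{1}} (hN : ℵ₀ ≤ N) (hMN : M ≤ N)
    (hG : colNumOn E G ≤ M) (hA : A ⊆ G) (hB : B ⊆ G) (hAN : #A ≤ N)
    (hBA : ∀ b ∈ B, M ≤ #{y | y ∈ A ∧ E y b}) : #B ≤ N := by
  obtain ⟨h, hinj, hh⟩ := aux_get_h hG
  have hsub : B ⊆ ⋃ a : A, {y | y ∈ G ∧ E y a ∧ h y < h a} := by
    intro b hb
    have : ∃ a ∈ A, E a b ∧ ¬ h a < h b := by
      by_contra! hcon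
      refine absurd (hBA b hb) (not_le.2 (lt_of_le_of_lt (mk_le_mk_of_subset ?_) (hh b (hB hb))))
      exact fun y hy => ⟨hA hy.1, hy.2, hcon y hy.1 hy.2⟩
    obtain ⟨a, ha, hab, hlt⟩ := this
    refine mem_iUnion.2 ⟨⟨a, ha⟩, hB hb, hsym hab, lt_of_le_of_ne (not_lt.1 hlt) ?_⟩
    intro heq
    have := hinj (hB hb) (hA ha) heq
    subst this
    exact hirr _ hab
  refine (mk_le_mk_of_subset hsub).trans ((mk_iUnion_le _).trans ?_)
  have hsup : (⨆ a : A, #{y | y ∈ G ∧ E y a ∧ h y < h a}) ≤ N :=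
    ciSup_le' fun a => ((hh a.1 (hA a.2)).le.trans hMN)
  calc _ ≤ N * N := mul_le_mul' hAN hsup
    _ = N := mul_eq_self hN

/-- sets of size `< κ` below `κ` are bounded -/
lemma aux_bdd {κ : Cardinal.{0}} (hκ : κ.IsRegular) {B : Set Ordinal.{0}} (hB : ∀ b ∈ B, b < κ.ord)
    (hc : #B < Cardinal.lift.{1} κ) : ∃ g < κ.ord, ∀ b ∈ B, b < g := by
  refine ⟨sSup (Set.image (· + 1) B), Ordinal.sSup_add_one_lt_of_lt_cof ?_ hB, fun b hb => ?_⟩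
  · rwa [← Ordinal.lift_cof, hκ.cof_ord]
  · refine lt_of_lt_of_le (lt_add_one b) (le_csSup ⟨κ.ord, ?_⟩ (mem_image_of_mem _ hb))
    rintro _ ⟨x, hx, rfl⟩
    exact Order.add_one_le_of_lt (hB x hx)

lemma aux_small {μ κ : Cardinal.{0}} (hκreg : κ.IsRegular)
    {E : Ordinal.{0} → Ordinal.{0} → Prop} (hsym : Symmetric E) (hirr : ∀ α, ¬ E α α)
    (hsmall : ∀ α < κ.ord, colNumOn E (Set.Iio α) ≤ Cardinal.lift.{1} μ)
    {ν : Cardinal.{0}} (hν : ℵ₀ ≤ ν) (hμν : μ ≤ ν) (hνκ : Order.succ ν < κ) {a : Ordinal.{0}}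
    (ha : a < κ.ord) {A : Set Ordinal.{0}} (hA : A ⊆ Iio a) (hAν : #A ≤ Cardinal.lift.{1} ν) :
    #{b | b < κ.ord ∧ Cardinal.lift.{1} μ ≤ #{y | y ∈ A ∧ E y b}} ≤ Cardinal.lift.{1} ν := by
  by_contra! hlt
  obtain ⟨B, hB, hBc⟩ := le_mk_iff_exists_subset.1 (Order.succ_le_of_lt hlt)
  obtain ⟨g, hg, hgB⟩ := aux_bdd hκreg (B := B) (fun b hb => (hB hb).1) (by
    rw [hBc, ← lift_succ]; exact lift_lt.2 hνκ)
  have := aux_count hsym hirr (N := Cardinal.lift.{1} ν) (A := A) (B := B) (by simpa using hν) (lift_le.2 hμν)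
    (hsmall (max a g) (max_lt ha hg))
    (fun x hx => mem_Iio.2 (lt_max_of_lt_left (mem_Iio.1 (hA hx))))
    (fun x hx => mem_Iio.2 (lt_max_of_lt_right (hgB x hx))) hAν
    (fun b hb => (hB hb).2)
  rw [hBc] at this
  exact absurd this (not_le.2 (Order.lt_succ _))

lemma aux_claim {μ κ : Cardinal.{0}} (hμ : ℵ₀ ≤ μ) (hκreg : κ.IsRegular)
    (hκnotsucc : ¬ ∃ lam : Cardinal.{0}, ℵ₀ ≤ lam ∧ lam.ord.cof < lam ∧
      lam.ord.cof = μ.ord.cof ∧ κ = Order.succ lam)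
    {E : Ordinal.{0} → Ordinal.{0} → Prop} (hsym : Symmetric E) (hirr : ∀ α, ¬ E α α)
    (hsmall : ∀ α < κ.ord, colNumOn E (Set.Iio α) ≤ Cardinal.lift.{1} μ)
    (hμκ : Order.succ μ < κ) {a : Ordinal.{0}} (ha : a < κ.ord) :
    #{b | b < κ.ord ∧ Cardinal.lift.{1} μ ≤ #{y | y ∈ Iio a ∧ E y b}} < Cardinal.lift.{1} κ := by
  have hac : a.card < κ := lt_ord.1 ha
  have hμκ' : μ < κ := (Order.lt_succ μ).trans hμκ
  have hνκ : max a.card μ < κ := max_lt hac hμκ'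
  rcases (Order.succ_le_of_lt hνκ).lt_or_eq with hlt | heq
  · refine (aux_small hκreg hsym hirr hsmall (hμ.trans (le_max_right _ _)) (le_max_right _ _) hlt ha
      subset_rfl ?_).trans_lt (lift_lt.2 hνκ)
    rw [mk_Iio_ordinal]
    exact lift_le.2 (le_max_left _ _)
  · have hμa : μ < a.card := by
      by_contra! hle
      rw [max_eq_right hle] at heq
      exact absurd heq hμκ.ne
    rw [max_eq_left hμa.le] at heq
    set ν := a.card with hν
    have hν0 : ℵ₀ ≤ ν := hμ.trans hμa.le
    have hcof : ν.ord.cof ≠ μ.ord.cof := by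
      intro h
      refine hκnotsucc ⟨ν, hν0, ?_, h, heq.symm⟩
      rw [h]
      exact (Ordinal.cof_ord_le μ).trans_lt hμa
    have hcard : #(Iio a) = #(Iio ν.ord) := by
      rw [mk_Iio_ordinal, mk_Iio_ordinal, card_ord]
    obtain ⟨e⟩ := Cardinal.eq.1 hcard
    let A : Iio ν.ord → Set Ordinal.{0} := fun i => {y | ∃ hy : y ∈ Iio a, e ⟨y, hy⟩ < i}
    have hAa : ∀ i, A i ⊆ Iio a := fun i y hy => hy.1
    have hAc : ∀ i, #(A i) ≤ Cardinal.lift.{1} i.1.card := by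
      intro i
      rw [← mk_Iio_ordinal]
      refine mk_le_of_injective (f := fun y => ⟨(e ⟨y.1, y.2.1⟩).1, y.2.2⟩) ?_
      intro y z hyz
      have h1 := congrArg Subtype.val hyz
      have h2 := e.injective (Subtype.ext h1)
      have h3 := congrArg Subtype.val h2
      exact Subtype.ext h3
    have hsub : {b | b < κ.ord ∧ Cardinal.lift.{1} μ ≤ #{y | y ∈ Iio a ∧ E y b}} ⊆
        ⋃ i : Iio ν.ord, {b | b < κ.ord ∧ Cardinal.lift.{1} μ ≤ #{y | y ∈ A i ∧ E y b}} := by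
      rintro b ⟨hb, hbμ⟩
      by_contra hcon
      simp only [mem_iUnion, mem_ofPred_eq, not_exists, not_and, not_le] at hcon
      let X : Set (Iio ν.ord) := {i | E (e.symm i).1 b}
      have hX : #{y | y ∈ Iio a ∧ E y b} ≤ #X := by
        refine mk_le_of_injective (f := fun y => ⟨e ⟨y.1, y.2.1⟩, ?_⟩) ?_
        · have := y.2.2
          simpa [X] using this
        · intro y z hyz
          simpa [Subtype.ext_iff] using hyz
      have h1 := aux_cof (Cardinal.lift.{1} μ) X (fun i => ?_) (hbμ.trans hX)
      · rw [Ordinal.cof_Iio, ← Ordinal.lift_cof, ← Cardinal.lift_ord, ← Ordinal.lift_cof] at h1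
        exact hcof (Cardinal.lift_injective h1)
      · refine lt_of_le_of_lt ?_ (hcon i hb)
        refine mk_le_of_injective (f := fun j => ⟨(e.symm j.1).1, ⟨(e.symm j.1).2, ?_⟩, j.2.1⟩) ?_
        · simpa using j.2.2
        · intro y z hyz
          have h1 := congrArg Subtype.val hyz
          have h2 := e.symm.injective (Subtype.ext h1)
          exact Subtype.ext h2
    have hsucc : Cardinal.lift.{1} κ = Order.succ (Cardinal.lift.{1} ν) := by
      rw [← heq, lift_succ]
    rw [hsucc, Order.lt_succ_iff]
    refine (mk_le_mk_of_subset hsub).trans ((mk_iUnion_le _).trans ?_)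
    rw [mk_Iio_ordinal, card_ord]
    refine (mul_le_mul' le_rfl (ciSup_le' fun i => ?_)).trans
      (mul_eq_self (by simpa using hν0)).le
    have hiν : i.1.card < ν := lt_ord.1 i.2
    have hm : max i.1.card μ < ν := max_lt hiν hμa
    refine (aux_small hκreg hsym hirr hsmall (hμ.trans (le_max_right _ _)) (le_max_right i.1.card _)
      ?_ ha (hAa i) ?_).trans (lift_le.2 hm.le)
    · exact (Order.succ_le_of_lt hm).trans_lt hac
    · exact (hAc i).trans (lift_le.2 (le_max_left _ _))

theorem statement2 (μ κ : Cardinal.{0}) (hμ : ℵ₀ ≤ μ) (hκinf : ℵ₀ ≤ κ)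
    (hκreg : κ.IsRegular)
    (hκnotsucc : ¬ ∃ lam : Cardinal.{0}, ℵ₀ ≤ lam ∧ lam.ord.cof < lam ∧
      lam.ord.cof = μ.ord.cof ∧ κ = Order.succ lam)
    (E : Ordinal → Ordinal → Prop) (hsym : Symmetric E) (hirr : ∀ α, ¬ E α α)
    (hsmall : ∀ α < κ.ord, colNumOn E (Set.Iio α) ≤ Cardinal.lift.{1} μ) :
    colNumOn E (Set.Iio κ.ord) ≤ Cardinal.lift.{1} (Order.succ μ) := by
  rcases le_or_gt κ (Order.succ μ) with hle | hμκ
  · refine aux_of_h id (injOn_id _) fun x hx => ?_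
    have h1 : #(Iio x) < Cardinal.lift.{1} (Order.succ μ) := by
      rw [mk_Iio_ordinal]
      exact lift_lt.2 ((lt_ord.1 hx).trans_le hle)
    exact (mk_le_mk_of_subset fun y hy => hy.2.2).trans_lt h1
  let D : Ordinal.{0} → Set Ordinal.{0} := fun a =>
    {b | b < κ.ord ∧ Cardinal.lift.{1} μ ≤ #{y | y ∈ Iio a ∧ E y b}}
  have hDmono : ∀ {a b}, a ≤ b → D a ⊆ D b := by
    rintro a b hab x ⟨hx, hx2⟩
    exact ⟨hx, hx2.trans (mk_le_mk_of_subset fun y hy => ⟨lt_of_lt_of_le hy.1 hab, hy.2⟩)⟩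
  let g : Ordinal.{0} → Ordinal.{0} := fun a => sSup (Set.image (· + 1) (D a))
  have hgD : ∀ a, ∀ b ∈ D a, b < g a := by
    intro a b hb
    refine lt_of_lt_of_le (lt_add_one b) (le_csSup ⟨κ.ord, ?_⟩ (mem_image_of_mem _ hb))
    rintro _ ⟨x, hx, rfl⟩
    exact Order.add_one_le_of_lt hx.1
  have hgκ : ∀ a < κ.ord, g a < κ.ord := by
    intro a ha
    refine Ordinal.sSup_add_one_lt_of_lt_cof ?_ fun b hb => hb.1
    rw [← Ordinal.lift_cof, hκreg.cof_ord]
    exact aux_claim hμ hκreg hκnotsucc hsym hirr hsmall hμκ ha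
  let P : Ordinal.{0} → Prop := fun t => ∀ a < t, ∀ b, t ≤ b → b < κ.ord →
    #{y | y ∈ Iio a ∧ E y b} < Cardinal.lift.{1} μ
  let nx : Ordinal.{0} → Ordinal.{0} := fun x => Ordinal.nfp g (x + 1)
  have hκ0 : κ ≠ ℵ₀ := (hμ.trans_lt ((Order.lt_succ μ).trans hμκ)).ne'
  have hnx : ∀ x < κ.ord, nx x < κ.ord := by
    intro x hx
    refine nfp_lt_ord_of_isRegular hκreg hκ0 hgκ ?_
    exact (isSuccLimit_ord hκinf).add_one_lt hx
  have hlt : ∀ x, x < nx x := fun x => (lt_add_one x).trans_le (Ordinal.le_nfp _ _)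
  have hPnx : ∀ x, P (nx x) := by
    intro x a ha b hb hbκ
    by_contra! hcon
    obtain ⟨n, hn⟩ := Ordinal.lt_nfp_iff.1 ha
    have h1 : b ∈ D (g^[n] (x + 1)) := hDmono hn.le ⟨hbκ, hcon⟩
    have h2 := hgD _ _ h1
    rw [← Function.iterate_succ_apply' g] at h2
    exact absurd ((h2.trans_le (Ordinal.iterate_le_nfp _ _ _)).trans_le hb) (lt_irrefl _)
  let c : Ordinal.{0} → Ordinal.{0} := fun x => sSup {t | t ≤ x ∧ P t}
  have hbdd : ∀ x, BddAbove {t | t ≤ x ∧ P t} := fun x => ⟨x, fun t ht => ht.1⟩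
  have hcx : ∀ x, c x ≤ x := fun x => csSup_le' fun t ht => ht.1
  have hPc : ∀ x, P (c x) := by
    intro x a ha b hb hbκ
    obtain ⟨t, ht, hat⟩ := exists_lt_of_lt_csSup' ha
    exact ht.2 a hat b ((le_csSup (hbdd x) ht).trans hb) hbκ
  have hle : ∀ x t, P t → t ≤ x → t ≤ c x := fun x t ht htx => le_csSup (hbdd x) ⟨htx, ht⟩
  have hblock : ∀ x, x < nx (c x) := by
    intro x
    by_contra! h
    exact absurd ((hlt _).trans_le (hle x _ (hPnx _) h)) (lt_irrefl _)
  have hex : ∀ s, ∃ h : Ordinal.{0} → Ordinal.{1}, s < κ.ord → InjOn h (Iio (nx s)) ∧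
      ∀ x ∈ Iio (nx s), #{y | y ∈ Iio (nx s) ∧ E y x ∧ h y < h x} < Cardinal.lift.{1} μ := by
    intro s
    by_cases hs : s < κ.ord
    · obtain ⟨h, hh⟩ := aux_get_h (hsmall _ (hnx s hs))
      exact ⟨h, fun _ => hh⟩
    · exact ⟨fun _ => 0, fun h => absurd h hs⟩
  choose h hh using hex
  refine aux_of_h (γ := Ordinal.{0} ×ₗ Ordinal.{1}) (fun x => toLex (c x, h (c x) x)) ?_ ?_
  · intro x hx y hy hxy
    have h1 : c x = c y ∧ h (c x) x = h (c y) y := by simpa using hxy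
    refine (hh (c x) ((hcx x).trans_lt hx)).1 (hblock x) ?_ ?_
    · rw [h1.1]; exact hblock y
    · rw [h1.2, h1.1]
  · intro x hx
    have hsub : {y | y ∈ Iio κ.ord ∧ E y x ∧ toLex (c y, h (c y) y) < toLex (c x, h (c x) x)} ⊆
        {y | y ∈ Iio (c x) ∧ E y x} ∪
        {y | y ∈ Iio (nx (c x)) ∧ E y x ∧ h (c x) y < h (c x) x} := by
      rintro y ⟨hy, hE, hl⟩
      rcases Prod.Lex.toLex_lt_toLex.1 hl with h1 | ⟨h1, h2⟩
      · left
        refine ⟨?_, hE⟩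
        by_contra! hcon
        exact absurd (h1.trans_le (hle y _ (hPc x) (not_lt.1 hcon))) (lt_irrefl _)
      · right
        dsimp only at h1 h2
        rw [h1] at h2
        exact ⟨h1 ▸ hblock y, hE, h2⟩
    rw [lift_succ, Order.lt_succ_iff]
    refine (mk_le_mk_of_subset hsub).trans ((mk_union_le _ _).trans ?_)
    have hM : ℵ₀ ≤ Cardinal.lift.{1} μ := by simpa using hμ
    refine (add_le_add ?_ ((hh (c x) ((hcx x).trans_lt hx)).2 x (hblock x)).le).trans
      (add_eq_self hM).le
    refine aux_card_le _ fun z => (aux_Iio_sub _ z).trans_lt ?_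
    refine lt_of_le_of_lt (mk_le_mk_of_subset ?_) (hPc x z.1 z.2.1 x (hcx x) hx)
    exact fun y hy => ⟨hy.2, hy.1.2⟩
end

section
/- Suppose μ and κ are infinite cardinals with κ regular. If 𝒢 = (κ, E) is a graph on the vertex set κ and, for every α < κ, Col(𝒢_α) ≤ μ, then Col(𝒢) ≤ μ⁺⁺. -/
open Cardinal

namespace ColGap

universe u

theorem exists_initial {α : Type u} (r : α → α → Prop) [IsWellOrder α r] (A : Set α)
    (θ : Cardinal.{u}) (h : θ < #A) : ∃ x ∈ A, θ ≤ #{y : α | y ∈ A ∧ r y x} := by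
  let s : A → A → Prop := fun a b => r a b
  have : IsWellOrder A s := (Subrel.relEmbedding r (· ∈ A)).isWellOrder
  have h1 : θ.ord < Ordinal.type s := by
    by_contra hcon
    have := Ordinal.card_le_card (not_lt.1 hcon)
    rw [Ordinal.card_type, Cardinal.card_ord] at this
    exact absurd h (not_lt.2 this)
  let x : A := Ordinal.enum s ⟨θ.ord, h1⟩
  have h2 : #{y // s y x} = θ := by
    rw [← Ordinal.card_typein, Ordinal.typein_enum, Cardinal.card_ord]
  refine ⟨x, x.2, ?_⟩
  rw [← h2]
  refine Cardinal.mk_le_of_injective (f := fun y => ⟨y.1.1, y.1.2, y.2⟩) ?_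
  rintro ⟨⟨a, ha⟩, ha'⟩ ⟨⟨b, hb⟩, hb'⟩ hab
  simpa using hab

theorem union_lt {α ι : Type u} {K : Cardinal.{u}} (hK : K.IsRegular) (f : ι → Set α)
    (hι : #ι < K) (hf : ∀ i, #(f i) < K) : #(⋃ i, f i) < K :=
  (Cardinal.mk_iUnion_le_sum_mk).trans_lt (Cardinal.sum_lt_of_isRegular hK hι hf)

variable {V : Type u} [LinearOrder V] [WellFoundedLT V]

theorem bounded_of_lt (hreg : (#V).IsRegular) (hseg : ∀ a : V, #(Set.Iio a) < #V)
    (S : Set V) (hS : #S < #V) : ∃ γ, ∀ x ∈ S, x < γ := by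
  by_contra hcon
  push Not at hcon
  have h1 : (⋃ x : S, Set.Iic x.1) = Set.univ := by
    ext γ
    obtain ⟨x, hx, hγ⟩ := hcon γ
    simp only [Set.mem_iUnion, Set.mem_univ, iff_true]
    exact ⟨⟨x, hx⟩, hγ⟩
  have h2 := union_lt hreg (fun x : S => Set.Iic x.1) hS (fun x => by
    rw [← Set.Iio_insert]
    refine (Cardinal.mk_insert_le).trans_lt ?_
    exact Cardinal.add_lt_of_lt hreg.aleph0_le (hseg _) (by simpa using hreg.nat_lt 1))
  rw [h1, Cardinal.mk_univ] at h2
  exact lt_irrefl _ h2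

theorem counting (hreg : (#V).IsRegular) (hseg : ∀ a : V, #(Set.Iio a) < #V)
    (M : Cardinal.{u}) (hM : ℵ₀ ≤ M) (E : V → V → Prop) (hsym : ∀ x y, E x y → E y x)
    (hirr : ∀ x, ¬ E x x)
    (hsmall : ∀ a : V, ∃ ρ : V → Ordinal.{u}, Set.InjOn ρ (Set.Iio a) ∧
      ∀ x < a, #{y : V | y < a ∧ E y x ∧ ρ y < ρ x} < M)
    (Z : Set V) (hZ : Order.succ (max #Z M) < #V) :
    #{b : V | M ≤ #{z : V | z ∈ Z ∧ E z b}} < #V := by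
  by_contra hcon
  push Not at hcon
  obtain ⟨X, hX, hXc⟩ := Cardinal.le_mk_iff_exists_subset.1 (hZ.le.trans hcon)
  have hmax : max #Z M < #V := (Order.le_succ _).trans_lt hZ
  obtain ⟨γ, hγ⟩ := bounded_of_lt hreg hseg (X ∪ Z) ((Cardinal.mk_union_le _ _).trans_lt
    (Cardinal.add_lt_of_lt hreg.aleph0_le (hXc ▸ hZ) ((le_max_left _ _).trans_lt hmax)))
  obtain ⟨ρ, hinj, hρ⟩ := hsmall γ
  have hsub : X ⊆ ⋃ z : Z, {y : V | y < γ ∧ E y z.1 ∧ ρ y < ρ z.1} := by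
    intro x hx
    have hxγ := hγ x (Or.inl hx)
    by_contra hno
    simp only [Set.mem_iUnion, not_exists] at hno
    have : {z : V | z ∈ Z ∧ E z x} ⊆ {y : V | y < γ ∧ E y x ∧ ρ y < ρ x} := by
      rintro z ⟨hz, hzx⟩
      have hzγ := hγ z (Or.inr hz)
      refine ⟨hzγ, hzx, ?_⟩
      rcases lt_trichotomy (ρ z) (ρ x) with h | h | h
      · exact h
      · have := hinj hzγ hxγ h
        subst this
        exact absurd hzx (hirr _)
      · exact absurd ⟨hxγ, hsym _ _ hzx, h⟩ (hno ⟨z, hz⟩)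
    exact absurd (hX hx) (not_le.2 ((Cardinal.mk_le_mk_of_subset this).trans_lt (hρ x hxγ)))
  have h1 := Cardinal.mk_le_mk_of_subset hsub
  have h2 : #X ≤ max #Z M := by
    refine h1.trans (Cardinal.mk_iUnion_le_sum_mk.trans ?_)
    refine (Cardinal.sum_le_sum _ (fun _ : Z => M) (fun z : Z => (hρ z.1 (hγ z.1 (Or.inr z.2))).le)).trans ?_
    rw [Cardinal.sum_const']
    exact (Cardinal.mul_le_max_of_aleph0_le_right hM)
  rw [hXc] at h2
  exact absurd h2 (not_le.2 (Order.lt_succ _))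

theorem claimA (hreg : (#V).IsRegular) (hseg : ∀ a : V, #(Set.Iio a) < #V)
    (M : Cardinal.{u}) (hM : ℵ₀ ≤ M) (hMV : Order.succ M < #V)
    (E : V → V → Prop) (hsym : ∀ x y, E x y → E y x)
    (hirr : ∀ x, ¬ E x x)
    (hsmall : ∀ a : V, ∃ ρ : V → Ordinal.{u}, Set.InjOn ρ (Set.Iio a) ∧
      ∀ x < a, #{y : V | y < a ∧ E y x ∧ ρ y < ρ x} < M)
    (δ : V) : #{b : V | M < #{z : V | z < δ ∧ E z b}} < #V := by
  obtain ⟨r, hr, hord⟩ := Cardinal.exists_ord_eq (Set.Iio δ)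
  let Z : Set.Iio δ → Set V := fun ζ => Subtype.val '' {y : Set.Iio δ | r y ζ}
  have hZ : ∀ ζ, #(Z ζ) < #(Set.Iio δ) := by
    intro ζ
    refine Cardinal.mk_image_le.trans_lt ?_
    have := Cardinal.card_typein_lt (r := r) ζ hord
    rwa [Ordinal.card_typein] at this
  have hU := union_lt hreg (fun ζ => {b : V | M ≤ #{z : V | z ∈ Z ζ ∧ E z b}}) (hseg δ) (fun ζ => by
    refine counting hreg hseg M hM E hsym hirr hsmall (Z ζ) ?_
    rcases le_total #(Z ζ) M with h | h
    · rwa [max_eq_right h]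
    · rw [max_eq_left h]
      exact (Order.succ_le_of_lt (hZ ζ)).trans_lt (hseg δ))
  refine (Cardinal.mk_le_mk_of_subset ?_).trans_lt hU
  intro b hb
  have hb' : M < #{z : Set.Iio δ | E z b} := by
    refine lt_of_lt_of_le hb ?_
    refine Cardinal.mk_le_of_injective (f := fun y => ⟨⟨y.1, y.2.1⟩, y.2.2⟩) ?_
    rintro ⟨a, ha⟩ ⟨c, hc⟩ hac
    exact Subtype.ext (congrArg (fun t => t.1.1) hac)
  obtain ⟨ζ, -, hζ⟩ := exists_initial r _ M hb'
  refine Set.mem_iUnion.2 ⟨ζ, hζ.trans ?_⟩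
  refine Cardinal.mk_le_of_injective (f := fun y => ⟨y.1.1, ⟨y.1, y.2.2, rfl⟩, y.2.1⟩) ?_
  rintro ⟨⟨a, ha⟩, ha'⟩ ⟨⟨b, hb⟩, hb'⟩ hab
  simpa using hab

theorem main (hreg : (#V).IsRegular) (hseg : ∀ a : V, #(Set.Iio a) < #V)
    (M : Cardinal.{u}) (hM : ℵ₀ ≤ M)
    (E : V → V → Prop) (hsym : ∀ x y, E x y → E y x)
    (hirr : ∀ x, ¬ E x x)
    (hsmall : ∀ a : V, ∃ ρ : V → Ordinal.{u}, Set.InjOn ρ (Set.Iio a) ∧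
      ∀ x < a, #{y : V | y < a ∧ E y x ∧ ρ y < ρ x} < M) :
    ∃ r : V → V → Prop, IsWellOrder V r ∧
      ∀ x, #{y : V | E y x ∧ r y x} < Order.succ (Order.succ M) := by
  rcases lt_or_ge (Order.succ M) #V with hMV | hMV
  swap
  · refine ⟨(· < ·), inferInstance, fun x => ?_⟩
    refine lt_of_lt_of_le ((Cardinal.mk_le_mk_of_subset (fun y hy => hy.2)).trans_lt (hseg x)) ?_
    exact hMV.trans (Order.le_succ _)
  have hh : ∀ δ : V, ∃ γ, ∀ b, M < #{z : V | z < δ ∧ E z b} → b < γ := fun δ =>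
    bounded_of_lt hreg hseg _ (claimA hreg hseg M hM hMV E hsym hirr hsmall δ)
  choose h hh using hh
  let C : Set V := {α | ∀ δ < α, ∀ b, M < #{z : V | z < δ ∧ E z b} → b < α}
  have hC : ∀ x : V, ∃ α, α ∈ C ∧ x < α := by
    intro x
    obtain ⟨x', hx'⟩ := bounded_of_lt hreg hseg {x} (by simpa using hreg.nat_lt 1)
    let a : ℕ → V := fun n => h^[n] x'
    have hb : ∃ γ, ∀ n, a n ≤ γ := by
      obtain ⟨γ, hγ⟩ := bounded_of_lt hreg hseg (Set.range a) (by
        refine lt_of_le_of_lt ?_ (hM.trans_lt ((Order.lt_succ M).trans hMV))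
        exact Cardinal.mk_le_aleph0_iff.2 (Set.countable_range a).to_subtype)
      exact ⟨γ, fun n => (hγ _ ⟨n, rfl⟩).le⟩
    obtain ⟨γ, hγ, hmin⟩ := WellFounded.has_min (wellFounded_lt (α := V)) {γ | ∀ n, a n ≤ γ} hb
    refine ⟨γ, ?_, (hx' x rfl).trans_le (hγ 0)⟩
    intro δ hδ b hb
    have : ∃ n, δ < a n := by
      by_contra hno
      push Not at hno
      exact hmin δ hno hδ
    obtain ⟨n, hn⟩ := this
    have h1 : b < h (a n) := hh (a n) b (hb.trans_le (Cardinal.mk_le_mk_of_subset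
      (fun z hz => ⟨hz.1.trans hn, hz.2⟩)))
    refine h1.trans_le ?_
    have := hγ (n + 1)
    simpa only [a, Function.iterate_succ_apply'] using this
  have hn : ∀ x : V, ∃ n, n ∈ C ∧ x < n ∧ ∀ α ∈ C, x < α → n ≤ α := by
    intro x
    obtain ⟨n, hn, hmin⟩ := WellFounded.has_min (wellFounded_lt (α := V)) {α | α ∈ C ∧ x < α} (hC x)
    exact ⟨n, hn.1, hn.2, fun α h1 h2 => not_lt.1 (hmin α ⟨h1, h2⟩)⟩
  choose n hnC hxn hnmin using hn
  choose ρ hinj hρ using hsmall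
  let f : V → V × Ordinal.{u} := fun x => (n x, ρ (n x) x)
  have hf : Function.Injective f := by
    intro x y hxy
    simp only [f, Prod.mk.injEq] at hxy
    obtain ⟨h1, h2⟩ := hxy
    rw [← h1] at h2
    exact hinj (n x) (hxn x) (h1 ▸ hxn y) h2
  let e : (InvImage (Prod.Lex (· < ·) (· < ·)) f) ↪r
      (Prod.Lex ((· < ·) : V → V → Prop) ((· < ·) : Ordinal.{u} → Ordinal.{u} → Prop)) :=
    ⟨⟨f, hf⟩, Iff.rfl⟩
  have : IsWellOrder (V × Ordinal.{u}) (Prod.Lex (· < ·) (· < ·)) := inferInstance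
  refine ⟨_, e.isWellOrder, fun x => Order.lt_succ_of_le ?_⟩
  have hsub : {y : V | E y x ∧ InvImage (Prod.Lex (· < ·) (· < ·)) f y x} ⊆
      {y : V | E y x ∧ n y < n x} ∪ {y : V | y < n x ∧ E y x ∧ ρ (n x) y < ρ (n x) x} := by
    rintro y ⟨hy, hyx⟩
    rcases (Prod.lex_def.1 hyx) with h1 | ⟨h1, h2⟩
    · exact Or.inl ⟨hy, h1⟩
    · simp only [f] at h1 h2
      refine Or.inr ⟨h1 ▸ hxn y, hy, ?_⟩
      rwa [h1] at h2
  refine (Cardinal.mk_le_mk_of_subset hsub).trans ((Cardinal.mk_union_le _ _).trans ?_)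
  refine Cardinal.add_le_of_le (hM.trans (Order.le_succ M)) ?_
    ((hρ (n x) x (hxn x)).le.trans (Order.le_succ M))
  by_contra hcon
  push Not at hcon
  obtain ⟨y, hyA, hy⟩ := exists_initial ((· < ·) : V → V → Prop) {y : V | E y x ∧ n y < n x} _ hcon
  have h1 : x < n y := by
    refine hnC y y (hxn y) x (lt_of_lt_of_le (Order.lt_succ M) (hy.trans ?_))
    exact Cardinal.mk_le_mk_of_subset (fun z hz => ⟨hz.2, hz.1.1⟩)
  exact absurd (hnmin x _ (hnC y) h1) (not_le.2 hyA.2)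

end ColGap

theorem statement3 (μ κ : Cardinal.{0}) (hμ : ℵ₀ ≤ μ) (hκinf : ℵ₀ ≤ κ)
    (hκreg : κ.IsRegular)
    (E : Ordinal → Ordinal → Prop) (hsym : Symmetric E) (hirr : ∀ α, ¬ E α α)
    (hsmall : ∀ α < κ.ord, colNumOn E (Set.Iio α) ≤ Cardinal.lift.{1} μ) :
    colNumOn E (Set.Iio κ.ord) ≤ Cardinal.lift.{1} (Order.succ (Order.succ μ)) := by
  have hV : #(Set.Iio κ.ord) = Cardinal.lift.{1} κ := by
    rw [Cardinal.mk_Iio_ordinal, Cardinal.card_ord]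
  have key := ColGap.main (V := Set.Iio κ.ord) (by rw [hV]; exact hκreg.lift) (fun a => by
      rw [hV]
      have h1 : #(Set.Iio a) ≤ #(Set.Iio a.1) :=
        Cardinal.mk_le_of_injective (f := fun y => ⟨y.1.1, y.2⟩) (by
          rintro ⟨⟨a, ha⟩, ha'⟩ ⟨⟨b, hb⟩, hb'⟩ hab
          exact Subtype.ext (Subtype.ext (congrArg (fun t => t.1) hab)))
      refine h1.trans_lt ?_
      rw [Cardinal.mk_Iio_ordinal, Cardinal.lift_lt]
      exact Cardinal.lt_ord.1 a.2)
    (Cardinal.lift.{1} μ) (by simpa using hμ) (fun x y => E x y) (fun x y h => hsym h)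
    (fun x => hirr x) (by
      intro a
      have hne : {c : Cardinal.{1} | ∃ r : Set.Iio a.1 → Set.Iio a.1 → Prop,
          IsWellOrder (Set.Iio a.1) r ∧
          ∀ x : Set.Iio a.1, #{y : Set.Iio a.1 // E ↑y ↑x ∧ r y x} < c}.Nonempty :=
        ⟨Order.succ #(Set.Iio a.1), (· < ·), inferInstance, fun x =>
          Order.lt_succ_of_le (Cardinal.mk_subtype_le _)⟩
      obtain ⟨r, hr, hrlt⟩ := csInf_mem hne
      have hle := hsmall a.1 a.2
      refine ⟨fun x => if hx : x < a then Ordinal.typein r ⟨x.1, hx⟩ else 0, ?_, ?_⟩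
      · intro x hx y hy hxy
        have hx' : x < a := hx
        have hy' : y < a := hy
        simp only [hx', hy', dif_pos] at hxy
        have := (Ordinal.typein_injective r) hxy
        exact Subtype.ext (congrArg (fun t => t.1) this)
      · intro x hx
        refine lt_of_le_of_lt ?_ ((hrlt ⟨x.1, hx⟩).trans_le hle)
        refine Cardinal.mk_le_of_injective
          (f := fun y => ⟨⟨y.1.1, y.2.1⟩, y.2.2.1, ?_⟩) ?_
        · have h1 := y.2.2.2
          have hy : y.1 < a := y.2.1
          simp only [hx, hy, dif_pos] at h1
          exact (Ordinal.typein_lt_typein r).1 h1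
        · rintro ⟨⟨a, ha⟩, ha'⟩ ⟨⟨b, hb⟩, hb'⟩ hab
          exact Subtype.ext (Subtype.ext (congrArg (fun t => t.1.1) hab)))
  obtain ⟨r, hr, hlt⟩ := key
  refine csInf_le' ⟨r, hr, fun x => ?_⟩
  rw [Cardinal.lift_succ, Cardinal.lift_succ]
  exact hlt x
end

section
/- Suppose λ is a singular cardinal of countable cofinality and the Chang's Conjecture variant (λ⁺, λ) ↠ (ℵ₁, ℵ₀) holds. If 𝒢 = (λ⁺, E) is a graph on the vertex set λ⁺ and Col(𝒢_α) ≤ ℵ₀ for all α < λ⁺, then Col(𝒢) ≤ ℵ₁. -/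
open Cardinal FirstOrder FirstOrder.Language

/-- The Chang's Conjecture variant `(κ₁, λ₁) ↠ (κ₀, λ₀)`: for every structure `M` of size `κ₁`
in a countable first-order language containing a unary predicate interpreted as a set `U` of
size `λ₁`, there is an elementary substructure `B` with `|B| = κ₀` and `|B ∩ U| = λ₀`. -/
def ChangCC (kap1 lam1 kap0 lam0 : Cardinal.{0}) : Prop :=
  ∀ (L : FirstOrder.Language.{0, 0}) (M : Type) [L.Structure M],
    L.card ≤ ℵ₀ → #M = kap1 →
    ∀ U : Set M, #U = lam1 →
    (∃ r : L.Relations 1, ∀ x : M, Structure.RelMap r ![x] ↔ x ∈ U) →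
    ∃ B : L.ElementarySubstructure M,
      #(B : Set M) = kap0 ∧ #(↥(U ∩ (B : Set M))) = lam0

/-- Extract a finite-to-one rank function from a bound on the coloring number. -/
theorem exists_rank_of_col (E : Ordinal.{0} → Ordinal.{0} → Prop) (A : Set Ordinal.{0})
    (h : colNumOn E A ≤ Cardinal.lift.{1} (ℵ₀ : Cardinal.{0})) :
    ∃ rk : Ordinal.{0} → Ordinal.{1}, Set.InjOn rk A ∧
      ∀ x ∈ A, {y | y ∈ A ∧ E y x ∧ rk y < rk x}.Finite := by
  classical
  have hne : {c : Cardinal.{1} | ∃ r : A → A → Prop, IsWellOrder A r ∧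
      ∀ x : A, #{y : A // E ↑y ↑x ∧ r y x} < c}.Nonempty :=
    ⟨Order.succ #A, (· < ·), inferInstance, fun x =>
      Order.lt_succ_of_le (Cardinal.mk_subtype_le _)⟩
  obtain ⟨r, hr, hc⟩ := csInf_mem hne
  refine ⟨fun x => if hx : x ∈ A then Ordinal.typein r ⟨x, hx⟩ else 0, ?_, ?_⟩
  · intro x hx y hy hxy
    simp only [hx, hy, dif_pos] at hxy
    have := Ordinal.typein_injective r hxy
    simpa using this
  · intro x hx
    have h1 := (hc ⟨x, hx⟩).trans_le h
    rw [Cardinal.lift_aleph0, Cardinal.lt_aleph0_iff_finite] at h1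
    have h2 : (Set.range (fun y : {y : A // E ↑y x ∧ r y ⟨x, hx⟩} => (y.1.1 : Ordinal))).Finite :=
      Set.finite_range _
    refine h2.subset ?_
    rintro y ⟨hy, hE, hlt⟩
    simp only [hx, hy, dif_pos, Ordinal.typein_lt_typein] at hlt
    exact ⟨⟨⟨y, hy⟩, hE, hlt⟩, rfl⟩

theorem col_le_of_key {W : Type*} [LinearOrder W] [WellFoundedLT W]
    (E : Ordinal.{0} → Ordinal.{0} → Prop) (A : Set Ordinal.{0})
    (key : Ordinal.{0} → W) (hinj : Set.InjOn key A)
    (hc : ∀ x ∈ A, {y | y ∈ A ∧ E y x ∧ key y < key x}.Countable) :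
    colNumOn E A ≤ Cardinal.lift.{1} (Cardinal.aleph 1 : Cardinal.{0}) := by
  refine csInf_le' ⟨fun a b => key a < key b, ?_, ?_⟩
  · let f : (fun a b : A => key a < key b) ↪r ((· < ·) : W → W → Prop) :=
      ⟨⟨fun a => key a, fun a b h => Subtype.ext (hinj a.2 b.2 h)⟩, Iff.rfl⟩
    exact f.isWellOrder
  · rintro ⟨x, hx⟩
    have h1 := hc x hx
    have h3 : Countable {y : A // E ↑y x ∧ key y < key x} := by
      have := h1.to_subtype
      refine Function.Injective.countable
        (f := fun y => (⟨y.1.1, y.1.2, y.2⟩ : {y | y ∈ A ∧ E y x ∧ key y < key x})) ?_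
      intro a b hab
      simpa [Subtype.ext_iff] using hab
    have h4 := Cardinal.mk_le_aleph0_iff.2 h3
    refine h4.trans_lt ?_
    rw [← Cardinal.lift_aleph0.{1,0}, Cardinal.lift_lt]
    exact Cardinal.aleph0_lt_aleph_one

/-- Function symbols. -/
inductive ChFun : ℕ → Type
  | mk (n : ℕ) : ChFun 1

/-- Relation symbols. -/
inductive ChRel : ℕ → Type
  | mk : ChRel 1

theorem chang_apply {k l : Cardinal.{0}} (hCC : ChangCC k l (Cardinal.aleph 1) ℵ₀)
    (M : Type) (hM : #M = k) (U : Set M) (hU : #U = l) (f : ℕ → M → M) :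
    ∃ B : Set M, #B = Cardinal.aleph 1 ∧ #(↥(U ∩ B)) = ℵ₀ ∧ ∀ n, ∀ x ∈ B, f n x ∈ B := by
  let L : FirstOrder.Language.{0, 0} := ⟨ChFun, ChRel⟩
  letI : L.Structure M :=
    { funMap := fun {n} g => match n, g with
        | _, ChFun.mk i => fun v => f i (v 0)
      RelMap := fun {n} g => match n, g with
        | _, ChRel.mk => fun v => v 0 ∈ U }
  have hL : L.card ≤ ℵ₀ := by
    unfold FirstOrder.Language.card
    rw [Cardinal.mk_le_aleph0_iff]
    have h1 : Countable (Σ l, L.Functions l) := by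
      refine Function.Surjective.countable (f := fun n : ℕ => (⟨1, ChFun.mk n⟩ : Σ l, L.Functions l)) ?_
      rintro ⟨_, ⟨n⟩⟩
      exact ⟨n, rfl⟩
    have h2 : Countable (Σ l, L.Relations l) := by
      refine Function.Surjective.countable (f := fun n : ℕ => (⟨1, ChRel.mk⟩ : Σ l, L.Relations l)) ?_
      rintro ⟨_, ⟨⟩⟩
      exact ⟨0, rfl⟩
    infer_instance
  obtain ⟨B, hB1, hB2⟩ := hCC L M hL hM U hU ⟨ChRel.mk, fun x => Iff.rfl⟩
  refine ⟨B, hB1, hB2, fun n x hx => ?_⟩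
  exact B.toSubstructure.fun_mem (ChFun.mk n) (fun _ => x) (fun _ => hx)

theorem bounded_of_small (lam : Cardinal.{0}) (hlam : ℵ₀ ≤ lam) (s : Set Ordinal.{0})
    (hs : ∀ a ∈ s, a < (Order.succ lam).ord) (hc : #s ≤ Cardinal.lift.{1} lam) :
    ∃ b < (Order.succ lam).ord, ∀ a ∈ s, a < b := by
  have hcof : #s < (Ordinal.lift.{1} (Order.succ lam).ord).cof := by
    rw [← Ordinal.lift_cof, (Cardinal.isRegular_succ hlam).cof_ord]
    exact hc.trans_lt (Cardinal.lift_lt.2 (Order.lt_succ lam))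
  refine ⟨_, Ordinal.sSup_add_one_lt_of_lt_cof hcof hs, fun a ha => ?_⟩
  have hbdd : BddAbove ((· + 1) '' s) := by
    refine ⟨(Order.succ lam).ord, ?_⟩
    rintro _ ⟨a, ha, rfl⟩
    exact Order.add_one_le_of_lt (hs a ha)
  exact (Order.lt_add_one_iff.2 le_rfl).trans_le (le_csSup hbdd ⟨a, ha, rfl⟩)

theorem infinite_nbrs_bounded (lam : Cardinal.{0}) (hlam : ℵ₀ < lam)
    (hCC : ChangCC (Order.succ lam) lam ((Cardinal.aleph 1 : Cardinal.{0})) ℵ₀)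
    (E : Ordinal.{0} → Ordinal.{0} → Prop) (hsym : Symmetric E)
    (hsmall : ∀ α < (Order.succ lam).ord,
      colNumOn E (Set.Iio α) ≤ Cardinal.lift.{1} (ℵ₀ : Cardinal.{0}))
    (γ₀ : Ordinal.{0}) (hγ₀ : γ₀ < (Order.succ lam).ord) :
    ∃ b < (Order.succ lam).ord, ∀ β < (Order.succ lam).ord,
      {y | y < γ₀ ∧ E y β}.Infinite → β < b := by
  classical
  by_contra hcon
  have hlk : lam.ord < (Order.succ lam).ord := Cardinal.ord_lt_ord.2 (Order.lt_succ lam)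
  obtain ⟨γ, hγ, hγ0, hγl⟩ : ∃ γ < (Order.succ lam).ord, γ₀ ≤ γ ∧ lam.ord ≤ γ :=
    ⟨max γ₀ lam.ord, max_lt hγ₀ hlk, le_max_left _ _, le_max_right _ _⟩
  let S : Set Ordinal.{0} :=
    {o | o < (Order.succ lam).ord ∧ (o < γ ∨ {y | y < γ ∧ E y o}.Infinite)}
  have hSsub : S ⊆ Set.Iio (Order.succ lam).ord := fun o ho => ho.1
  haveI : Small.{0} S := small_subset hSsub
  have hScard : #S = Cardinal.lift.{1} (Order.succ lam) := by
    apply le_antisymm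
    · refine (Cardinal.mk_le_mk_of_subset hSsub).trans ?_
      rw [Cardinal.mk_Iio_ordinal, Cardinal.card_ord]
    · rw [Cardinal.lift_succ, Order.succ_le_iff]
      by_contra hle
      obtain ⟨b, hb, hb'⟩ := bounded_of_small lam hlam.le S (fun a ha => ha.1) (not_lt.1 hle)
      refine hcon ⟨b, hb, fun β hβ hinf => hb' β ⟨hβ, Or.inr (hinf.mono ?_)⟩⟩
      rintro y ⟨h1, h2⟩
      exact ⟨h1.trans_le hγ0, h2⟩
  let e : S ≃ Shrink.{0} S := equivShrink S
  have hM : #(Shrink.{0} S) = Order.succ lam := by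
    apply Cardinal.lift_injective.{1}
    rw [← hScard]
    exact (Cardinal.lift_mk_eq'.2 ⟨e.symm⟩).trans (Cardinal.lift_id' _)
  let U : Set (Shrink.{0} S) := {m | (e.symm m).1 < γ}
  have hU : #U = lam := by
    apply Cardinal.lift_injective.{1}
    have h1 : Cardinal.lift.{1} #U = #(Set.Iio γ) := by
      refine (Cardinal.lift_mk_eq'.2 ⟨?_⟩).trans (Cardinal.lift_id' _)
      exact
        { toFun := fun m => ⟨(e.symm m.1).1, m.2⟩
          invFun := fun y => ⟨e ⟨y.1, lt_trans y.2 hγ, Or.inl y.2⟩, by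
            have hy : y.1 < γ := y.2; simp only [U, Set.mem_setOf_eq, Equiv.symm_apply_apply]; exact hy⟩
          left_inv := fun m => by ext; simp
          right_inv := fun m => by ext; simp }
    rw [h1, Cardinal.mk_Iio_ordinal, Cardinal.lift_inj]
    apply le_antisymm
    · exact Order.lt_succ_iff.1 (Cardinal.lt_ord.1 hγ)
    · exact Cardinal.ord_le.1 hγl
  let f : ℕ → Shrink.{0} S → Shrink.{0} S := fun n m =>
    if h : {y | y < γ ∧ E y (e.symm m).1}.Infinite then
      e ⟨(h.natEmbedding _ n).1, lt_trans (h.natEmbedding _ n).2.1 hγ,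
        Or.inl (h.natEmbedding _ n).2.1⟩
    else m
  obtain ⟨B, hB1, hB2, hBf⟩ := chang_apply hCC _ hM U hU f
  -- B is bounded
  let g : Shrink.{0} S → Ordinal.{0} := fun m => (e.symm m).1
  have hg : Function.Injective g := fun a b h => e.symm.injective (Subtype.ext h)
  have hBcard : #(g '' B) = Cardinal.lift.{1} (Cardinal.aleph 1 : Cardinal.{0}) := by
    rw [← hB1]
    exact (Cardinal.lift_id' _).symm.trans (Cardinal.mk_image_eq_lift _ _ hg)
  have hal : (Cardinal.aleph 1 : Cardinal.{0}) ≤ lam := by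
    rw [← Cardinal.succ_aleph0]
    exact Order.succ_le_of_lt hlam
  obtain ⟨α, hα, hBα⟩ := bounded_of_small lam hlam.le (g '' B)
    (by rintro _ ⟨m, _, rfl⟩; exact (e.symm m).2.1)
    (hBcard.le.trans (Cardinal.lift_le.2 hal))
  obtain ⟨rk, hrk, hfin⟩ := exists_rank_of_col E _ (hsmall α hα)
  let A : Set Ordinal.{0} := g '' (U ∩ B)
  have hA : A.Countable := by
    have : (U ∩ B).Countable := Cardinal.mk_le_aleph0_iff.1 hB2.le
    exact this.image _
  have hAα : ∀ y ∈ A, y ∈ Set.Iio α := by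
    rintro _ ⟨m, hm, rfl⟩
    exact hBα _ ⟨m, hm.2, rfl⟩
  let A' : Set Ordinal.{0} := A ∪ ⋃ y ∈ A, {x | x ∈ Set.Iio α ∧ E x y ∧ rk x < rk y}
  have hA' : A'.Countable :=
    hA.union (hA.biUnion fun y hy => (hfin y (hAα y hy)).countable)
  have hBunc : ¬ (g '' B).Countable := by
    intro h
    have h2 := Cardinal.mk_le_aleph0_iff.2 h.to_subtype
    rw [hBcard, ← Cardinal.lift_aleph0.{1,0}, Cardinal.lift_le] at h2
    exact absurd Cardinal.aleph0_lt_aleph_one (not_lt.2 h2)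
  obtain ⟨β, hβB, hβA⟩ : ∃ β ∈ g '' B, β ∉ A' := by
    by_contra hno
    push Not at hno
    exact hBunc (hA'.mono hno)
  obtain ⟨m, hm, rfl⟩ := hβB
  have hmU : m ∉ U := fun h => hβA (Or.inl ⟨m, ⟨h, hm⟩, rfl⟩)
  have hinf : {y | y < γ ∧ E y (e.symm m).1}.Infinite := (e.symm m).2.2.resolve_left hmU
  have hgf : ∀ n, g (f n m) = (hinf.natEmbedding _ n).1 := by
    intro n
    simp only [g, f, dif_pos hinf, Equiv.symm_apply_apply]
  have hinj : Function.Injective (fun n => g (f n m)) := by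
    intro a b hab
    simp only [hgf] at hab
    exact (hinf.natEmbedding _).injective (Subtype.ext hab)
  refine Set.infinite_range_of_injective hinj ((hfin (g m) (hBα _ ⟨m, hm, rfl⟩)).subset ?_)
  rintro _ ⟨n, rfl⟩
  have hE : g (f n m) < γ ∧ E (g (f n m)) (g m) := by
    rw [hgf]; exact (hinf.natEmbedding _ n).2
  have hyA : g (f n m) ∈ A := ⟨f n m, ⟨hE.1, hBf n m hm⟩, rfl⟩
  refine ⟨hAα _ hyA, hE.2, ?_⟩
  rcases lt_trichotomy (rk (g (f n m))) (rk (g m)) with h | h | h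
  · exact h
  · exact absurd (Or.inl (hrk (hAα _ hyA) (hBα _ ⟨m, hm, rfl⟩) h ▸ hyA)) hβA
  · refine absurd (Or.inr ?_) hβA
    simp only [Set.mem_iUnion]
    exact ⟨_, hyA, hBα _ ⟨m, hm, rfl⟩, hsym hE.2, h⟩

theorem countable_of_finite_initial (T : Set Ordinal.{0})
    (h : ∀ a ∈ T, {y | y ∈ T ∧ y < a}.Finite) : T.Countable := by
  have hi : Set.InjOn (fun a => {y | y ∈ T ∧ y < a}.ncard) T := by
    have key : ∀ a ∈ T, ∀ b ∈ T, a < b →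
        {y | y ∈ T ∧ y < a}.ncard < {y | y ∈ T ∧ y < b}.ncard := by
      intro a ha b hb hab
      refine Set.ncard_lt_ncard ⟨fun y hy => ⟨hy.1, hy.2.trans hab⟩, fun hsub => ?_⟩ (h b hb)
      exact lt_irrefl a (hsub ⟨ha, hab⟩).2
    intro a ha b hb hab
    rcases lt_trichotomy a b with hlt | heq | hlt
    · exact absurd hab (key a ha b hb hlt).ne
    · exact heq
    · exact absurd hab (key b hb a ha hlt).ne'
  exact Set.MapsTo.countable_of_injOn (t := Set.univ) (fun _ _ => trivial) hi Set.countable_univ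

theorem statement5 (lam : Cardinal.{0}) (hlam : ℵ₀ < lam) (hcof : lam.ord.cof = ℵ₀)
    (hCC : ChangCC (Order.succ lam) lam ((Cardinal.aleph 1 : Cardinal.{0})) ℵ₀)
    (E : Ordinal → Ordinal → Prop) (hsym : Symmetric E) (hirr : ∀ α, ¬ E α α)
    (hsmall : ∀ α < (Order.succ lam).ord, colNumOn E (Set.Iio α) ≤ Cardinal.lift.{1} (ℵ₀ : Cardinal.{0})) :
    colNumOn E (Set.Iio (Order.succ lam).ord) ≤ Cardinal.lift.{1} ((Cardinal.aleph 1 : Cardinal.{0})) := by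
  classical
  have hb := infinite_nbrs_bounded lam hlam hCC E hsym hsmall
  have hlim : Order.IsSuccLimit (Order.succ lam).ord :=
    Cardinal.isSuccLimit_ord (hlam.le.trans (Order.le_succ lam))
  generalize hκ : (Order.succ lam).ord = κ at *
  choose! g hgκ hg using hb
  let C : Set Ordinal.{0} :=
    {a | ∀ a' < a, ∀ β < κ, {y | y < a' ∧ E y β}.Infinite → β < a}
  -- unboundedness
  have hunb : ∀ x < κ, ∃ c ∈ C, x < c ∧ c < κ := by
    intro x hx
    let s : ℕ → Ordinal.{0} := fun n => Nat.rec (x + 1) (fun _ a => g a) n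
    have hs0 : s 0 = x + 1 := rfl
    have hss : ∀ n, s (n + 1) = g (s n) := fun n => rfl
    have hsκ : ∀ n, s n < κ := by
      intro n
      induction n with
      | zero => rw [hs0]; exact hlim.add_one_lt hx
      | succ n ih => rw [hss]; exact hgκ _ ih
    have hbdd : BddAbove (Set.range s) := ⟨κ, by rintro _ ⟨n, rfl⟩; exact (hsκ n).le⟩
    refine ⟨⨆ n, s n, ?_, ?_, ?_⟩
    · intro a' ha' β hβ hinf
      obtain ⟨n, hn⟩ := exists_lt_of_lt_ciSup ha'
      have : β < g (s n) := hg _ (hsκ n) β hβ (hinf.mono fun y hy => ⟨hy.1.trans hn, hy.2⟩)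
      exact this.trans_le (le_ciSup hbdd (n + 1))
    · exact (Order.lt_add_one_iff.2 le_rfl).trans_le (le_ciSup hbdd 0)
    · obtain ⟨b, hbκ, hb⟩ := bounded_of_small lam hlam.le (Set.range s)
        (by rintro _ ⟨n, rfl⟩; rw [hκ]; exact hsκ n)
        ((Cardinal.mk_le_aleph0_iff.2 (Set.countable_range s).to_subtype).trans (by
          rw [← Cardinal.lift_aleph0.{1,0}, Cardinal.lift_le]; exact hlam.le))
      rw [hκ] at hbκ
      exact (ciSup_le fun n => (hb _ ⟨n, rfl⟩).le).trans_lt hbκ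
  choose! nx hnxC hnxlt hnxκ using hunb
  -- projection to C
  let ρ : Ordinal.{0} → Ordinal.{0} := fun x => sSup {c | c ∈ C ∧ c ≤ x}
  have hbd : ∀ x, BddAbove {c | c ∈ C ∧ c ≤ x} := fun x => ⟨x, fun c hc => hc.2⟩
  have hne : ∀ x, {c | c ∈ C ∧ c ≤ x}.Nonempty := fun x =>
    ⟨0, fun a' ha' => absurd ha' not_lt_zero, zero_le⟩
  have hρle : ∀ x, ρ x ≤ x := fun x => csSup_le (hne x) fun c hc => hc.2
  have hρC : ∀ x, ρ x ∈ C := by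
    intro x a' ha' β hβ hinf
    obtain ⟨c, hc, hac⟩ := exists_lt_of_lt_csSup (hne x) ha'
    exact (hc.1 a' hac β hβ hinf).trans_le (le_csSup (hbd x) hc)
  have hρmax : ∀ x c, c ∈ C → c ≤ x → c ≤ ρ x := fun x c h1 h2 => le_csSup (hbd x) ⟨h1, h2⟩
  have hblock : ∀ x < κ, x < nx (ρ x) := by
    intro x hx
    by_contra hle
    have hρκ := (hρle x).trans_lt hx
    exact absurd (hnxlt _ hρκ) (not_lt.2 (hρmax x _ (hnxC _ hρκ) (not_lt.1 hle)))
  have hrk : ∀ p < κ, ∃ rk : Ordinal.{0} → Ordinal.{1}, Set.InjOn rk (Set.Iio (nx p)) ∧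
      ∀ x ∈ Set.Iio (nx p), {y | y ∈ Set.Iio (nx p) ∧ E y x ∧ rk y < rk x}.Finite :=
    fun p hp => exists_rank_of_col E _ (hsmall _ (hnxκ p hp))
  choose! rk hrki hrkf using hrk
  refine col_le_of_key (W := Ordinal.{0} ×ₗ Ordinal.{1}) E _
    (fun x => toLex (ρ x, rk (ρ x) x)) ?_ ?_
  · intro x hx y hy hxy
    have h1 : ρ x = ρ y := congrArg (fun z => (ofLex z).1) hxy
    have h2 : rk (ρ x) x = rk (ρ y) y := congrArg (fun z => (ofLex z).2) hxy
    have hy' := hblock y hy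
    rw [← h1] at h2 hy'
    exact hrki _ ((hρle x).trans_lt hx) (hblock x hx) hy' h2
  · intro x hx
    have hρκ := (hρle x).trans_lt hx
    have hc1 : {y | y < ρ x ∧ E y x}.Countable := by
      refine countable_of_finite_initial _ ?_
      rintro a ⟨ha, _⟩
      by_contra hinf
      have hinf' : {y | y < a ∧ E y x}.Infinite := by
        refine Set.Infinite.mono ?_ hinf
        rintro y ⟨⟨_, h1⟩, h2⟩
        exact ⟨h2, h1⟩
      exact absurd (hρC x a ha x hx hinf') (not_lt.2 (hρle x))
    refine (hc1.union (hrkf (ρ x) hρκ x (hblock x hx)).countable).mono ?_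
    rintro y ⟨hy, hE, hlt⟩
    rw [Prod.Lex.toLex_lt_toLex] at hlt
    rcases hlt with h | ⟨h, h'⟩
    · left
      refine ⟨?_, hE⟩
      by_contra hle
      exact absurd h (not_lt.2 (hρmax y _ (hρC x) (not_lt.1 hle)))
    · right
      simp only at h h'
      have hy' := hblock y hy
      rw [h] at h' hy'
      exact ⟨hy', hE, h'⟩
end

section
/- Let κ be a regular uncountable cardinal and B ⊆ κ. Define Φ : 𝒦(κ) → 𝒦(κ) by Φ(x) := cl(nacc(x) ∩ B) if sup(nacc(x) ∩ B) = sup(x), and Φ(x) := x ∖ sup(nacc(x) ∩ B) otherwise. Then Φ is a postprocessing function. -/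
open Cardinal

/-- `acc(C)`: the set of accumulation points of `C` belonging to `C`. -/
def accSet (C : Set Ordinal) : Set Ordinal :=
  {β | β ∈ C ∧ 0 < β ∧ sSup (C ∩ Set.Iio β) = β}

/-- `nacc(C) := C ∖ acc(C)`. -/
def naccSet (C : Set Ordinal) : Set Ordinal := C \ accSet C

/-- `acc⁺(C) := {α < sup(C) : sup(C ∩ α) = α > 0}`. -/
def accPlus (C : Set Ordinal) : Set Ordinal :=
  {β | β < sSup C ∧ 0 < β ∧ sSup (C ∩ Set.Iio β) = β}

/-- `cl(C) := C ∪ acc⁺(C)`. -/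
def clSet (C : Set Ordinal) : Set Ordinal := C ∪ accPlus C

/-- `𝒦(κ)`: the collection of nonempty subsets of `κ` that are club in their supremum. -/
def KSet (κ : Cardinal.{0}) : Set (Set Ordinal) :=
  {x | x ⊆ Set.Iio κ.ord ∧ x.Nonempty ∧ IsClubIn x (sSup x)}

/-- `Φ` is a postprocessing function: for every `x ∈ 𝒦(κ)`, `Φ(x)` is a club in `sup(x)`,
`acc(Φ(x)) ⊆ acc(x)`, and `Φ(x) ∩ ᾱ = Φ(x ∩ ᾱ)` for all `ᾱ ∈ acc(Φ(x))`. -/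
def IsPostprocessing (κ : Cardinal.{0}) (Φ : Set Ordinal → Set Ordinal) : Prop :=
  ∀ x ∈ KSet κ,
    IsClubIn (Φ x) (sSup x) ∧
    accSet (Φ x) ⊆ accSet x ∧
    ∀ ᾱ ∈ accSet (Φ x), Φ x ∩ Set.Iio ᾱ = Φ (x ∩ Set.Iio ᾱ)

theorem sup_iff {S : Set Ordinal.{0}} {β : Ordinal.{0}} (hS : S ⊆ Set.Iio β) (hβ : 0 < β) :
    sSup S = β ↔ ∀ γ < β, ∃ c ∈ S, γ < c := by
  have hb : BddAbove S := ⟨β, fun c hc => (hS hc).le⟩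
  constructor
  · intro h γ hγ
    rw [← h] at hγ
    by_contra! hc
    rcases S.eq_empty_or_nonempty with he | hne
    · rw [he] at h
      simp at h
      exact hβ.ne h
    · exact absurd (csSup_le hne hc) (not_le.2 hγ)
  · intro h
    obtain ⟨c0, hc0, -⟩ := h 0 hβ
    apply le_antisymm
    · exact csSup_le ⟨c0, hc0⟩ fun c hc => (hS hc).le
    · by_contra! hlt
      obtain ⟨c, hc, h1⟩ := h _ hlt
      exact absurd (le_csSup hb hc) (not_le.2 h1)

theorem lim_iff {C : Set Ordinal.{0}} {β : Ordinal.{0}} (hβ : 0 < β) :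
    sSup (C ∩ Set.Iio β) = β ↔ ∀ γ < β, ∃ c ∈ C, c < β ∧ γ < c := by
  rw [sup_iff Set.inter_subset_right hβ]
  simp only [Set.mem_inter_iff, Set.mem_Iio, and_assoc]

theorem mem_acc {C : Set Ordinal.{0}} {β : Ordinal.{0}} :
    β ∈ accSet C ↔ β ∈ C ∧ 0 < β ∧ ∀ γ < β, ∃ c ∈ C, c < β ∧ γ < c := by
  unfold accSet
  constructor
  · rintro ⟨h1, h2, h3⟩
    exact ⟨h1, h2, (lim_iff h2).1 h3⟩
  · rintro ⟨h1, h2, h3⟩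
    exact ⟨h1, h2, (lim_iff h2).2 h3⟩

theorem mem_accPlus {C : Set Ordinal.{0}} {β : Ordinal.{0}} :
    β ∈ accPlus C ↔ β < sSup C ∧ 0 < β ∧ ∀ γ < β, ∃ c ∈ C, c < β ∧ γ < c := by
  unfold accPlus
  constructor
  · rintro ⟨h1, h2, h3⟩
    exact ⟨h1, h2, (lim_iff h2).1 h3⟩
  · rintro ⟨h1, h2, h3⟩
    exact ⟨h1, h2, (lim_iff h2).2 h3⟩

theorem nacc_inter (x : Set Ordinal.{0}) (a : Ordinal.{0}) :
    naccSet (x ∩ Set.Iio a) = naccSet x ∩ Set.Iio a := by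
  ext β
  simp only [naccSet, Set.mem_sdiff, mem_acc, Set.mem_inter_iff, Set.mem_Iio]
  constructor
  · rintro ⟨⟨h1, h2⟩, h3⟩
    refine ⟨⟨h1, fun h => h3 ⟨⟨h1, h2⟩, h.2.1, fun γ hγ => ?_⟩⟩, h2⟩
    obtain ⟨c, hc, h5, h6⟩ := h.2.2 γ hγ
    exact ⟨c, ⟨hc, h5.trans h2⟩, h5, h6⟩
  · rintro ⟨⟨h1, h3⟩, h2⟩
    refine ⟨⟨h1, h2⟩, fun h => h3 ⟨h1, h.2.1, fun γ hγ => ?_⟩⟩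
    obtain ⟨c, hc, h5, h6⟩ := h.2.2 γ hγ
    exact ⟨c, hc.1, h5, h6⟩

theorem lim_cl {A : Set Ordinal.{0}} {β : Ordinal.{0}}
    (h : ∀ γ < β, ∃ c ∈ clSet A, c < β ∧ γ < c) : ∀ γ < β, ∃ c ∈ A, c < β ∧ γ < c := by
  intro γ hγ
  obtain ⟨c, hc, h1, h2⟩ := h γ hγ
  rcases hc with hc | hc
  · exact ⟨c, hc, h1, h2⟩
  · obtain ⟨d, hd, h3, h4⟩ := (mem_accPlus.1 hc).2.2 γ h2
    exact ⟨d, hd, h3.trans h1, h4⟩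

theorem statement12 (κ : Cardinal.{0}) (hκreg : κ.IsRegular) (hκunc : ℵ₀ < κ)
    (B : Set Ordinal) (hB : B ⊆ Set.Iio κ.ord) :
    IsPostprocessing κ (fun x =>
      if sSup (naccSet x ∩ B) = sSup x then clSet (naccSet x ∩ B)
      else x \ Set.Iio (sSup (naccSet x ∩ B))) := by
  rintro x ⟨-, ⟨x0, hx0⟩, hxs, hxu, hxc⟩
  have hδ : 0 < sSup x := lt_of_le_of_lt zero_le (hxs hx0)
  have key : ∀ a, naccSet (x ∩ Set.Iio a) ∩ B = (naccSet x ∩ B) ∩ Set.Iio a := by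
    intro a
    rw [nacc_inter, Set.inter_right_comm]
  have hAx : naccSet x ∩ B ⊆ x := fun c hc => hc.1.1
  simp only [key]
  generalize naccSet x ∩ B = A at *
  have hAb : BddAbove A := ⟨sSup x, fun c hc => (hxs (hAx hc)).le⟩
  by_cases hA : sSup A = sSup x
  · simp only [hA, if_true]
    have hAl := (sup_iff (hAx.trans hxs) hδ).1 hA
    refine ⟨⟨?_, ?_, ?_⟩, ?_, ?_⟩
    · rintro c (hc | hc)
      · exact hxs (hAx hc)
      · exact hA ▸ hc.1
    · intro β hβ
      obtain ⟨c, hc, h⟩ := hAl β hβ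
      exact ⟨c, Or.inl hc, h.le⟩
    · intro β hβ h0 h
      exact Or.inr (mem_accPlus.2 ⟨hA ▸ hβ, h0, lim_cl ((lim_iff h0).1 h)⟩)
    · intro β hβ
      obtain ⟨h1, h0, h⟩ := mem_acc.1 hβ
      have hx : ∀ γ < β, ∃ c ∈ x, c < β ∧ γ < c := fun γ hγ => by
        obtain ⟨c, hc, h⟩ := lim_cl h γ hγ
        exact ⟨c, hAx hc, h⟩
      have hb : β < sSup x := by
        rcases h1 with hc | hc
        · exact hxs (hAx hc)
        · exact hA ▸ hc.1
      exact mem_acc.2 ⟨hxc β hb h0 ((lim_iff h0).2 hx), h0, hx⟩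
    · intro a ha
      obtain ⟨h1, h0, h⟩ := mem_acc.1 ha
      have h2 := lim_cl h
      have hx : ∀ γ < a, ∃ c ∈ x, c < a ∧ γ < c := fun γ hγ => by
        obtain ⟨c, hc, h⟩ := h2 γ hγ
        exact ⟨c, hAx hc, h⟩
      have ea := (lim_iff h0).2 h2
      have hb : a < sSup x := by
        rcases h1 with hc | hc
        · exact hxs (hAx hc)
        · exact hA ▸ hc.1
      rw [if_pos (ea.trans ((lim_iff h0).2 hx).symm)]
      ext c
      simp only [clSet, Set.mem_inter_iff, Set.mem_union, mem_accPlus, Set.mem_Iio, ea, hA]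
      constructor
      · rintro ⟨hc | ⟨h3, h4, h5⟩, hca⟩
        · exact Or.inl ⟨hc, hca⟩
        · refine Or.inr ⟨hca, h4, fun γ hγ => ?_⟩
          obtain ⟨d, hd, h6, h7⟩ := h5 γ hγ
          exact ⟨d, ⟨hd, h6.trans hca⟩, h6, h7⟩
      · rintro (hc | ⟨hca, h4, h5⟩)
        · exact ⟨Or.inl hc.1, hc.2⟩
        · refine ⟨Or.inr ⟨hca.trans hb, h4, fun γ hγ => ?_⟩, hca⟩
          obtain ⟨d, hd, h6, h7⟩ := h5 γ hγ
          exact ⟨d, hd.1, h6, h7⟩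
  · simp only [hA, if_false]
    have hlt : sSup A < sSup x := by
      refine lt_of_le_of_ne ?_ hA
      exact csSup_le' fun c hc => (hxs (hAx hc)).le
    refine ⟨⟨?_, ?_, ?_⟩, ?_, ?_⟩
    · exact fun c hc => hxs hc.1
    · intro β hβ
      obtain ⟨c, hc, h⟩ := hxu (max β (sSup A)) (max_lt hβ hlt)
      exact ⟨c, ⟨hc, not_lt.2 ((le_max_right _ _).trans h)⟩, (le_max_left _ _).trans h⟩
    · intro β hβ h0 h
      have h := (lim_iff h0).1 h
      refine ⟨hxc β hβ h0 ((lim_iff h0).2 fun γ hγ => ?_), ?_⟩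
      · obtain ⟨c, hc, h⟩ := h γ hγ
        exact ⟨c, hc.1, h⟩
      · obtain ⟨c, hc, h, -⟩ := h 0 h0
        exact not_lt.2 ((not_lt.1 hc.2).trans h.le)
    · intro β hβ
      obtain ⟨h1, h0, h⟩ := mem_acc.1 hβ
      refine mem_acc.2 ⟨h1.1, h0, fun γ hγ => ?_⟩
      obtain ⟨c, hc, h⟩ := h γ hγ
      exact ⟨c, hc.1, h⟩
    · intro a ha
      obtain ⟨h1, h0, h⟩ := mem_acc.1 ha
      have hx : ∀ γ < a, ∃ c ∈ x, c < a ∧ γ < c := fun γ hγ => by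
        obtain ⟨c, hc, h⟩ := h γ hγ
        exact ⟨c, hc.1, h⟩
      have hσ : sSup A < a := by
        obtain ⟨c, hc, h, -⟩ := h 0 h0
        exact (not_lt.1 hc.2).trans_lt h
      have e : A ∩ Set.Iio a = A :=
        Set.inter_eq_left.2 fun c hc => (le_csSup hAb hc).trans_lt hσ
      rw [e, (lim_iff h0).2 hx, if_neg hσ.ne]
      ext c
      simp only [Set.mem_inter_iff, Set.mem_sdiff]
      tauto
end

section
/- Let θ < κ be regular infinite cardinals with κ uncountable, and suppose ◊(κ) holds. Then there exists an acc-preserving postprocessing function Φ : 𝒦(κ) → 𝒦(κ) such that, for every sequence ⟨A_i : i < θ⟩ of cofinal subsets of κ, there exists a stationary subset G ⊆ κ such that for all x ∈ 𝒦(κ), if sup(nacc(x) ∩ G) = sup(x) and cf(sup(x)) = θ, then sup(nacc(Φ(x)) ∩ A_i) = sup(x) for all i < θ. -/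
open Cardinal

/-- The diamond principle `◊(κ)`. -/
def DiamondP (κ : Cardinal.{0}) : Prop :=
  ∃ Sseq : Ordinal → Set Ordinal, (∀ β, Sseq β ⊆ Set.Iio β) ∧
    ∀ S : Set Ordinal, IsStationaryIn {β | β < κ.ord ∧ S ∩ Set.Iio β = Sseq β} κ.ord


open Ordinal in
/-- Small suprema stay below. -/
theorem aux_bdd_s14 (o c : Ordinal.{0}) (h : o.card < c.cof) (F : Ordinal.{0} → Ordinal.{0})
    (hF : ∀ i < o, F i < c) : ∃ b < c, ∀ i < o, F i ≤ b := by
  refine ⟨⨆ i : o.ToType, F (ToType.toOrd i).1, ?_, ?_⟩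
  · apply Ordinal.iSup_lt_of_lt_cof
    · simpa using h
    · intro i
      exact hF _ (ToType.toOrd i).2
  · intro i hi
    have := Ordinal.le_iSup (fun i : o.ToType => F (ToType.toOrd i).1) (ToType.mk ⟨i, hi⟩)
    simpa using this

theorem aux_lt_of_sSup {D : Set Ordinal.{0}} {a g : Ordinal.{0}} (h : sSup D = a) (hg : g < a) :
    ∃ d ∈ D, g < d := by
  by_contra hc
  push Not at hc
  have : sSup D ≤ g := csSup_le' hc
  rw [h] at this
  exact absurd hg (not_lt.2 this)

theorem aux_sSup_eq {D : Set Ordinal.{0}} {a : Ordinal.{0}} (h : D ⊆ Set.Iio a)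
    (hg : ∀ g < a, ∃ d ∈ D, g < d) : sSup D = a := by
  apply le_antisymm
  · exact csSup_le' fun d hd => (h hd).le
  · by_contra hc
    push Not at hc
    obtain ⟨d, hd, hlt⟩ := hg _ hc
    exact absurd (le_csSup ⟨a, fun e he => (h he).le⟩ hd) (not_le.2 hlt)

theorem aux_club (κ : Cardinal.{0}) (hκ : κ.IsRegular) (hunc : ℵ₀ < κ)
    (h : Ordinal.{0} → Ordinal.{0}) (hh : ∀ g < κ.ord, h g < κ.ord) :
    IsClubIn {b | b < κ.ord ∧ 0 < b ∧ ∀ g < b, h g < b} κ.ord := by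
  have hlim : Order.IsSuccLimit κ.ord := Cardinal.isSuccLimit_ord hκ.1
  refine ⟨fun b hb => hb.1, ?_, ?_⟩
  · intro β hβ
    have key : ∀ g, ∃ b, g < κ.ord → b < κ.ord ∧ ∀ i < g + 1, h i < b := by
      intro g
      by_cases hg : g < κ.ord
      · have hg1 : g + 1 < κ.ord := hlim.add_one_lt hg
        obtain ⟨b, hb, hb'⟩ := aux_bdd_s14 (g + 1) κ.ord
          (by rw [hκ.cof_ord]; exact Cardinal.lt_ord.1 hg1) h
          (fun i hi => hh i (hi.trans hg1))
        exact ⟨b + 1, fun _ => ⟨hlim.add_one_lt hb, fun i hi => Order.lt_add_one_iff.2 (hb' i hi)⟩⟩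
      · exact ⟨0, fun h => absurd h hg⟩
    choose f hf using key
    have hlt : Ordinal.nfp f (β + 1) < κ.ord :=
      Ordinal.nfp_lt_ord (by rw [hκ.cof_ord]; exact hunc) (fun i hi => (hf i hi).1)
        (hlim.add_one_lt hβ)
    have hβ1 : β + 1 ≤ Ordinal.nfp f (β + 1) := Ordinal.le_nfp _ _
    have hβ2 : β < Ordinal.nfp f (β + 1) := lt_of_lt_of_le (Order.lt_add_one_iff.2 le_rfl) hβ1
    refine ⟨Ordinal.nfp f (β + 1), ⟨hlt, (zero_le).trans_lt hβ2, ?_⟩, hβ2.le⟩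
    intro g hg
    obtain ⟨n, hn⟩ := Ordinal.lt_nfp_iff.1 hg
    have hn1 : f^[n] (β + 1) < κ.ord := (Ordinal.iterate_le_nfp f _ n).trans_lt hlt
    have := (hf _ hn1).2 g (hn.trans (Order.lt_add_one_iff.2 le_rfl))
    refine this.trans_le ?_
    rw [← Function.iterate_succ_apply' f]
    exact Ordinal.iterate_le_nfp f _ _
  · intro β hβ hpos hs
    refine ⟨hβ, hpos, fun g hg => ?_⟩
    obtain ⟨d, hd, hgd⟩ := aux_lt_of_sSup hs hg
    exact (hd.1.2.2 g hgd).trans hd.2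

/-- rank along a set -/
noncomputable def auxRk (T : Set Ordinal.{0}) (b : Ordinal.{0}) : Ordinal.{0} :=
  sSup (Set.range fun c : {c : Set.Iio b // c.1 ∈ T} => auxRk T c.1.1 + 1)
termination_by b
decreasing_by exact c.1.2

theorem auxRk_lt (T : Set Ordinal.{0}) {b c : Ordinal.{0}} (hc : c ∈ T) (h : c < b) :
    auxRk T c < auxRk T b := by
  rw [← Order.add_one_le_iff]
  conv_rhs => rw [auxRk]
  apply le_csSup
  · exact Ordinal.bddAbove_of_small
  · exact ⟨⟨⟨c, h⟩, hc⟩, rfl⟩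

theorem auxRk_surj (T : Set Ordinal.{0}) (b : Ordinal.{0}) : ∀ e < auxRk T b,
    ∃ c ∈ T, c < b ∧ auxRk T c = e := by
  induction b using WellFoundedLT.induction with
  | ind b ih =>
    intro e he
    rw [auxRk] at he
    obtain ⟨d, ⟨⟨⟨c, hcb⟩, hcT⟩, rfl⟩, hd⟩ := aux_lt_of_sSup rfl he
    rcases (Order.lt_add_one_iff.1 hd).eq_or_lt with h | h
    · exact ⟨c, hcT, hcb, h.symm⟩
    · obtain ⟨c', h1, h2, h3⟩ := ih c hcb e h
      exact ⟨c', h1, h2.trans hcb, h3⟩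

theorem auxRk_congr (T T' : Set Ordinal.{0}) (b : Ordinal.{0})
    (h : ∀ c < b, c ∈ T ↔ c ∈ T') : auxRk T b = auxRk T' b := by
  induction b using WellFoundedLT.induction with
  | ind b ih =>
    have e : ∀ c < b, auxRk T c = auxRk T' c := fun c hc =>
      ih c hc fun d hd => h d (hd.trans hc)
    rw [auxRk, auxRk]
    congr 1
    ext z
    constructor
    · rintro ⟨⟨⟨c, hcb⟩, hcT⟩, rfl⟩
      exact ⟨⟨⟨c, hcb⟩, (h c hcb).1 hcT⟩, by simp only [e c hcb]⟩
    · rintro ⟨⟨⟨c, hcb⟩, hcT⟩, rfl⟩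
      exact ⟨⟨⟨c, hcb⟩, (h c hcb).2 hcT⟩, by simp only [e c hcb]⟩

/-- index choice -/
noncomputable def auxIdx (t η : Ordinal.{0}) : Ordinal.{0} :=
  (η % t) % 2 ^ Ordinal.log 2 (η % t)

theorem auxIdx_lt {t : Ordinal.{0}} (ht : t ≠ 0) (η : Ordinal.{0}) : auxIdx t η < t :=
  (Ordinal.mod_le _ _).trans_lt (Ordinal.mod_lt _ ht)

theorem auxIdx_hit (θ : Cardinal.{0}) (hθ : ℵ₀ ≤ θ) (q r i : Ordinal.{0}) (hr : r < θ.ord)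
    (hi : i < θ.ord) : ∃ r' < θ.ord, r ≤ r' ∧ auxIdx θ.ord (θ.ord * q + r') = i := by
  have hlim : Order.IsSuccLimit θ.ord := Cardinal.isSuccLimit_ord hθ
  have h2 : (2 : Ordinal.{0}) < θ.ord := by
    have : Ordinal.omega0 ≤ θ.ord := by rw [← Cardinal.ord_aleph0]; exact Cardinal.ord_le_ord.2 hθ
    exact lt_of_lt_of_le (Ordinal.natCast_lt_omega0 2) this
  have h12 : (1 : Ordinal.{0}) < 2 := by norm_num
  set ρ := max r i + 1 with hρ
  have hρl : ρ < θ.ord := hlim.add_one_lt (max_lt hr hi)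
  have hpow : (2 : Ordinal.{0}) ^ ρ < θ.ord := Ordinal.isPrincipal_opow_ord hθ h2 hρl
  have hle : ρ ≤ 2 ^ ρ := Ordinal.right_le_opow _ h12
  have hmax : max r i < 2 ^ ρ := lt_of_lt_of_le (Order.lt_add_one_iff.2 le_rfl) hle
  have hip : i < 2 ^ ρ := (le_max_right _ _).trans_lt hmax
  have hrp : r < 2 ^ ρ := (le_max_left _ _).trans_lt hmax
  have hr' : 2 ^ ρ * 1 + i < θ.ord := by
    rw [mul_one]; exact Ordinal.isPrincipal_add_ord hθ hpow hi
  refine ⟨2 ^ ρ * 1 + i, hr', ?_, ?_⟩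
  · rw [mul_one]; exact hrp.le.trans le_self_add
  · rw [auxIdx, Ordinal.mul_add_mod_self, Ordinal.mod_eq_of_lt hr',
      Ordinal.log_opow_mul_add h12 one_ne_zero hip]
    rw [Ordinal.log_one_right, add_zero, Ordinal.mul_add_mod_self, Ordinal.mod_eq_of_lt hip]

theorem auxHit (θ : Cardinal.{0}) (hθ : ℵ₀ ≤ θ) (T : Set Ordinal.{0}) (s : Ordinal.{0})
    (hcof : s.cof = θ) (hT : T ⊆ Set.Iio s) (hTu : ∀ g < s, ∃ d ∈ T, g < d)
    (i : Ordinal.{0}) (hi : i < θ.ord) (a : Ordinal.{0}) (ha : a < s) :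
    ∃ b ∈ T, a < b ∧ auxIdx θ.ord (auxRk T b) = i := by
  obtain ⟨a', ha'T, haa'⟩ := hTu a ha
  have ht0 : θ.ord ≠ 0 := (zero_le.trans_lt hi).ne'
  set η := auxRk T a' with hη
  set q := η / θ.ord
  have hdm : θ.ord * q + η % θ.ord = η := Ordinal.div_add_mod η θ.ord
  obtain ⟨r', hr', hrr', hidx⟩ := auxIdx_hit θ hθ q (η % θ.ord) i (Ordinal.mod_lt _ ht0) hi
  have hle : η ≤ θ.ord * q + r' := by
    conv_lhs => rw [← hdm]
    gcongr
  by_cases hlt : θ.ord * q + r' < auxRk T s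
  · obtain ⟨b, hbT, hbs, hb⟩ := auxRk_surj T s _ hlt
    refine ⟨b, hbT, haa'.trans_le ?_, by rw [hb]; exact hidx⟩
    by_contra hc
    push Not at hc
    have := auxRk_lt T hbT hc
    rw [hb] at this
    exact absurd hle (not_le.2 this)
  · exfalso
    push Not at hlt
    classical
    have hex : ∀ j, ∃ b < s, (∃ b' ∈ T, auxRk T b' = θ.ord * q + j) → b ∈ T ∧ auxRk T b = θ.ord * q + j := by
      intro j
      by_cases h : ∃ b' ∈ T, auxRk T b' = θ.ord * q + j
      · obtain ⟨b', h1, h2⟩ := h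
        exact ⟨b', hT h1, fun _ => ⟨h1, h2⟩⟩
      · exact ⟨a, ha, fun h' => absurd h' h⟩
    choose F hF1 hF2 using hex
    obtain ⟨B, hB, hB'⟩ := aux_bdd_s14 r' s (by rw [hcof]; exact Cardinal.lt_ord.1 hr') F
      (fun j _ => hF1 j)
    obtain ⟨d, hdT, hd⟩ := hTu (max B a') (max_lt hB (hT ha'T))
    have h1 : η < auxRk T d := auxRk_lt T ha'T ((le_max_right _ _).trans_lt hd)
    have h2 : auxRk T d < θ.ord * q + r' := (auxRk_lt T hdT (hT hdT)).trans_le hlt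
    have h3 : θ.ord * q ≤ auxRk T d := (Ordinal.mul_div_le _ _).trans h1.le
    obtain ⟨j, hj⟩ := exists_add_of_le h3
    have hjr : j < r' := by
      rw [hj] at h2
      exact lt_of_add_lt_add_left h2
    obtain ⟨h4, h5⟩ := hF2 j ⟨d, hdT, hj⟩
    have h6 : F j = d := by
      rcases lt_trichotomy (F j) d with h | h | h
      · have := auxRk_lt T h4 h
        rw [h5, hj] at this
        exact absurd this (lt_irrefl _)
      · exact h
      · have := auxRk_lt T hdT h
        rw [h5, hj] at this
        exact absurd this (lt_irrefl _)
    have := hB' j hjr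
    rw [h6] at this
    exact absurd ((le_max_left _ _).trans_lt hd) (not_lt.2 this)

/-- `S b` codes sets cofinal in `b`. -/
def auxGood (t : Ordinal.{0}) (S : Ordinal.{0} → Set Ordinal.{0}) (b : Ordinal.{0}) : Prop :=
  0 < b ∧ ∀ g < b, ∀ i < t, ∃ d, g < d ∧ d < b ∧ t * d + i ∈ S b

/-- Earlier compatible guesses. -/
def auxT (t : Ordinal.{0}) (S : Ordinal.{0} → Set Ordinal.{0}) (y : Set Ordinal.{0})
    (b : Ordinal.{0}) : Set Ordinal.{0} :=
  {c | c ∈ naccSet y ∧ auxGood t S c ∧ S b ∩ Set.Iio c = S c}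

open Classical in
/-- The new value at `b`, where `y` is the part of the ladder below `b`. -/
noncomputable def auxPhi (t : Ordinal.{0}) (S : Ordinal.{0} → Set Ordinal.{0})
    (y : Set Ordinal.{0}) (b : Ordinal.{0}) : Ordinal.{0} :=
  if sSup y < b ∧ auxGood t S b then
    sInf {d | sSup y < d ∧ t * d + auxIdx t (auxRk (auxT t S y b) b) ∈ S b}
  else b

/-- The postprocessing function. -/
noncomputable def auxΦ (t : Ordinal.{0}) (S : Ordinal.{0} → Set Ordinal.{0})
    (x : Set Ordinal.{0}) : Set Ordinal.{0} :=
  (fun b => auxPhi t S (x ∩ Set.Iio b) b) '' x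

theorem auxPhi_spec {t : Ordinal.{0}} (ht : t ≠ 0) {S : Ordinal.{0} → Set Ordinal.{0}}
    {y : Set Ordinal.{0}} {b : Ordinal.{0}} (h : sSup y < b) (hg : auxGood t S b) :
    sSup y < auxPhi t S y b ∧ auxPhi t S y b < b ∧
      t * auxPhi t S y b + auxIdx t (auxRk (auxT t S y b) b) ∈ S b := by
  obtain ⟨d, h1, h2, h3⟩ := hg.2 _ h _ (auxIdx_lt ht (auxRk (auxT t S y b) b))
  rw [auxPhi, if_pos ⟨h, hg⟩]
  have hm := csInf_mem (s := {d | sSup y < d ∧ t * d + auxIdx t (auxRk (auxT t S y b) b) ∈ S b})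
    ⟨d, h1, h3⟩
  refine ⟨hm.1, lt_of_le_of_lt (csInf_le' ?_) h2, hm.2⟩
  exact ⟨h1, h3⟩

theorem auxPhi_le {t : Ordinal.{0}} (ht : t ≠ 0) (S : Ordinal.{0} → Set Ordinal.{0})
    (y : Set Ordinal.{0}) (b : Ordinal.{0}) : auxPhi t S y b ≤ b := by
  by_cases h : sSup y < b ∧ auxGood t S b
  · exact (auxPhi_spec ht h.1 h.2).2.1.le
  · rw [auxPhi, if_neg h]

theorem auxPhi_gt {t : Ordinal.{0}} (ht : t ≠ 0) (S : Ordinal.{0} → Set Ordinal.{0})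
    (y : Set Ordinal.{0}) (b : Ordinal.{0}) (hb : sSup y < b) : sSup y < auxPhi t S y b := by
  by_cases h : auxGood t S b
  · exact (auxPhi_spec ht hb h).1
  · rw [auxPhi, if_neg fun h' => h h'.2]; exact hb

theorem auxPhi_acc {t : Ordinal.{0}} (S : Ordinal.{0} → Set Ordinal.{0})
    (y : Set Ordinal.{0}) (b : Ordinal.{0}) (hb : sSup y = b) : auxPhi t S y b = b := by
  rw [auxPhi, if_neg]
  rintro ⟨h, -⟩
  exact absurd hb h.ne

theorem aux_le_sSup_Iio {x : Set Ordinal.{0}} {b c : Ordinal.{0}} (hc : c ∈ x) (hcb : c < b) :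
    c ≤ sSup (x ∩ Set.Iio b) :=
  le_csSup ⟨b, fun _ h => h.2.le⟩ ⟨hc, hcb⟩

theorem aux_sSup_Iio_le (x : Set Ordinal.{0}) (b : Ordinal.{0}) :
    sSup (x ∩ Set.Iio b) ≤ b := csSup_le' fun _ h => h.2.le

theorem auxPhi_ge {t : Ordinal.{0}} (ht : t ≠ 0) (S : Ordinal.{0} → Set Ordinal.{0})
    (x : Set Ordinal.{0}) (b : Ordinal.{0}) :
    sSup (x ∩ Set.Iio b) ≤ auxPhi t S (x ∩ Set.Iio b) b := by
  rcases (aux_sSup_Iio_le x b).eq_or_lt with h | h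
  · rw [auxPhi_acc S _ _ h]; exact h.le
  · exact (auxPhi_gt ht S _ _ h).le

theorem auxPhi_strict {t : Ordinal.{0}} (ht : t ≠ 0) (S : Ordinal.{0} → Set Ordinal.{0})
    (x : Set Ordinal.{0}) {b c : Ordinal.{0}} (hc : c ∈ x) (hcb : c < b) :
    auxPhi t S (x ∩ Set.Iio c) c < auxPhi t S (x ∩ Set.Iio b) b := by
  have h1 := auxPhi_le ht S (x ∩ Set.Iio c) c
  rcases (aux_sSup_Iio_le x b).eq_or_lt with h | h
  · rw [auxPhi_acc S _ _ h]; exact h1.trans_lt hcb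
  · exact (h1.trans (aux_le_sSup_Iio hc hcb)).trans_lt (auxPhi_gt ht S _ _ h)

theorem auxΦ_lim {t : Ordinal.{0}} (ht : t ≠ 0) (S : Ordinal.{0} → Set Ordinal.{0})
    (x : Set Ordinal.{0}) (a : Ordinal.{0}) :
    sSup (auxΦ t S x ∩ Set.Iio a) = a ↔ sSup (x ∩ Set.Iio a) = a := by
  constructor
  · intro h
    refine aux_sSup_eq (fun _ h => h.2) fun g hg => ?_
    obtain ⟨_, ⟨⟨b, hb, rfl⟩, hba⟩, hgb⟩ := aux_lt_of_sSup h hg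
    obtain ⟨_, ⟨⟨c, hc, rfl⟩, hca⟩, hbc⟩ := aux_lt_of_sSup h hba
    simp only [Set.mem_Iio] at hgb hbc hca
    have hlt : b < c := by
      by_contra hn
      push Not at hn
      rcases hn.eq_or_lt with h | h
      · subst h; exact lt_irrefl _ hbc
      · exact absurd hbc (not_lt.2 (auxPhi_strict ht S x hc h).le)
    refine ⟨b, ⟨hb, ?_⟩, hgb.trans_le (auxPhi_le ht S _ _)⟩
    exact ((aux_le_sSup_Iio hb hlt).trans (auxPhi_ge ht S x c)).trans_lt hca
  · intro h
    refine aux_sSup_eq (fun _ h => h.2) fun g hg => ?_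
    obtain ⟨b, ⟨hb, hba⟩, hgb⟩ := aux_lt_of_sSup h hg
    obtain ⟨c, ⟨hc, hca⟩, hbc⟩ := aux_lt_of_sSup h hba
    exact ⟨_, ⟨⟨c, hc, rfl⟩, (auxPhi_le ht S _ _).trans_lt hca⟩,
      hgb.trans_le ((aux_le_sSup_Iio hb hbc).trans (auxPhi_ge ht S x c))⟩

theorem auxK_next {κ : Cardinal.{0}} {x : Set Ordinal.{0}} (hx : x ∈ KSet κ) {g : Ordinal.{0}}
    (hg : g < sSup x) : ∃ d ∈ x, g < d := aux_lt_of_sSup rfl hg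

theorem auxΦ_acc {t : Ordinal.{0}} (ht : t ≠ 0) (S : Ordinal.{0} → Set Ordinal.{0})
    {κ : Cardinal.{0}} {x : Set Ordinal.{0}} (hx : x ∈ KSet κ) :
    accSet (auxΦ t S x) = accSet x := by
  ext a
  constructor
  · rintro ⟨⟨b, hb, rfl⟩, hpos, hs⟩
    have hs' := (auxΦ_lim ht S x _).1 hs
    exact ⟨hx.2.2.2.2 _ ((auxPhi_le ht S _ _).trans_lt (hx.2.2.1 hb)) hpos hs', hpos, hs'⟩
  · rintro ⟨ha, hpos, hs⟩
    exact ⟨⟨a, ha, auxPhi_acc S _ _ hs⟩, hpos, (auxΦ_lim ht S x _).2 hs⟩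

theorem auxΦ_post {t : Ordinal.{0}} (ht : t ≠ 0) (S : Ordinal.{0} → Set Ordinal.{0})
    (κ : Cardinal.{0}) : IsPostprocessing κ (auxΦ t S) := by
  intro x hx
  refine ⟨⟨?_, ?_, ?_⟩, (auxΦ_acc ht S hx).le, ?_⟩
  · rintro _ ⟨b, hb, rfl⟩
    exact (auxPhi_le ht S _ _).trans_lt (hx.2.2.1 hb)
  · intro g hg
    obtain ⟨b, hb, hgb⟩ := auxK_next hx hg
    obtain ⟨c, hc, hbc⟩ := auxK_next hx (hx.2.2.1 hb)
    exact ⟨_, ⟨c, hc, rfl⟩, hgb.le.trans ((aux_le_sSup_Iio hb hbc).trans (auxPhi_ge ht S x c))⟩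
  · intro a ha hpos hs
    have hs' := (auxΦ_lim ht S x a).1 hs
    exact ⟨a, hx.2.2.2.2 a ha hpos hs', auxPhi_acc S _ _ hs'⟩
  · intro a ha
    rw [auxΦ_acc ht S hx] at ha
    have hcut : ∀ b < a, x ∩ Set.Iio a ∩ Set.Iio b = x ∩ Set.Iio b := by
      intro b hb
      rw [Set.inter_assoc, Set.Iio_inter_Iio, min_eq_right hb.le]
    ext z
    constructor
    · rintro ⟨⟨b, hb, rfl⟩, hz⟩
      have hba : b < a := by
        by_contra hn
        push Not at hn
        have h1 : auxPhi t S (x ∩ Set.Iio a) a = a := auxPhi_acc S _ _ ha.2.2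
        simp only [Set.mem_Iio] at hz
        rcases hn.eq_or_lt with h | h
        · subst h
          exact absurd hz (by rw [h1]; exact lt_irrefl _)
        · have := auxPhi_strict ht S x ha.1 h
          rw [h1] at this
          exact absurd hz (not_lt.2 this.le)
      exact ⟨b, ⟨hb, hba⟩, by simp only [hcut b hba]⟩
    · rintro ⟨b, ⟨hb, hba⟩, rfl⟩
      simp only [hcut b hba]
      exact ⟨⟨b, hb, rfl⟩, (auxPhi_le ht S _ _).trans_lt hba⟩

theorem aux_nacc_cut (x : Set Ordinal.{0}) {b c : Ordinal.{0}} (hc : c < b) :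
    c ∈ naccSet (x ∩ Set.Iio b) ↔ c ∈ naccSet x := by
  have hcut : x ∩ Set.Iio b ∩ Set.Iio c = x ∩ Set.Iio c := by
    rw [Set.inter_assoc, Set.Iio_inter_Iio, min_eq_right hc.le]
  simp only [naccSet, accSet, Set.mem_diff, Set.mem_setOf_eq, hcut, Set.mem_inter_iff, Set.mem_Iio,
    hc, and_true]

/-- The code of a sequence of sets. -/
def auxCode (t : Ordinal.{0}) (A : Ordinal.{0} → Set Ordinal.{0}) : Set Ordinal.{0} :=
  {z | ∃ i < t, ∃ d ∈ A i, z = t * d + i}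

theorem auxCode_mem {t : Ordinal.{0}} {A : Ordinal.{0} → Set Ordinal.{0}} {d i : Ordinal.{0}}
    (hi : i < t) (h : t * d + i ∈ auxCode t A) : d ∈ A i := by
  have ht : t ≠ 0 := (zero_le.trans_lt hi).ne'
  obtain ⟨j, hj, e, he, heq⟩ := h
  have h1 := congrArg (· / t) heq
  have h2 := congrArg (· % t) heq
  simp only [Ordinal.mul_add_div _ ht, Ordinal.div_eq_zero_of_lt hi, Ordinal.div_eq_zero_of_lt hj,
    add_zero] at h1
  simp only [Ordinal.mul_add_mod_self, Ordinal.mod_eq_of_lt hi, Ordinal.mod_eq_of_lt hj] at h2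
  subst h1 h2
  exact he

theorem aux_stat (θ κ : Cardinal.{0}) (hκreg : κ.IsRegular) (hθκ : θ < κ) (hκunc : ℵ₀ < κ)
    (S : Ordinal.{0} → Set Ordinal.{0})
    (hS : ∀ Z : Set Ordinal.{0}, IsStationaryIn {β | β < κ.ord ∧ Z ∩ Set.Iio β = S β} κ.ord)
    (A : Ordinal.{0} → Set Ordinal.{0})
    (hA : ∀ i < θ.ord, A i ⊆ Set.Iio κ.ord ∧ ∀ β < κ.ord, ∃ γ ∈ A i, β ≤ γ) :
    IsStationaryIn {β | β < κ.ord ∧ auxCode θ.ord A ∩ Set.Iio β = S β ∧ auxGood θ.ord S β}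
      κ.ord := by
  intro C hC
  have hlim : Order.IsSuccLimit κ.ord := Cardinal.isSuccLimit_ord hκreg.1
  have hθκ' : θ.ord < κ.ord := Cardinal.ord_lt_ord.2 hθκ
  have key : ∀ g, ∃ b, g < κ.ord → b < κ.ord ∧ (∃ c ∈ C, g < c ∧ c < b) ∧
      ∀ i < θ.ord, ∃ d ∈ A i, g < d ∧ θ.ord * d + i < b := by
    intro g
    by_cases hg : g < κ.ord
    swap
    · exact ⟨0, fun h => absurd h hg⟩
    have hg1 := hlim.add_one_lt hg
    obtain ⟨c, hcC, hc⟩ := hC.2.1 _ hg1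
    have hd : ∀ i, ∃ d, i < θ.ord → d ∈ A i ∧ g < d := by
      intro i
      by_cases hi : i < θ.ord
      · obtain ⟨d, hd, hgd⟩ := (hA i hi).2 _ hg1
        exact ⟨d, fun _ => ⟨hd, Order.add_one_le_iff.1 hgd⟩⟩
      · exact ⟨0, fun h => absurd h hi⟩
    choose D hD using hd
    obtain ⟨B, hB, hB'⟩ := aux_bdd_s14 θ.ord κ.ord (by rw [hκreg.cof_ord]; simpa using hθκ)
      (fun i => θ.ord * D i + i) (fun i hi => Ordinal.isPrincipal_add_ord hκreg.1
        (Ordinal.isPrincipal_mul_ord hκreg.1 hθκ' ((hA i hi).1 (hD i hi).1)) (hi.trans hθκ'))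
    refine ⟨max B c + 1, fun _ => ⟨hlim.add_one_lt (max_lt hB (hC.1 hcC)), ⟨c, hcC,
      Order.add_one_le_iff.1 hc, Order.lt_add_one_iff.2 (le_max_right _ _)⟩, fun i hi => ?_⟩⟩
    exact ⟨D i, (hD i hi).1, (hD i hi).2,
      Order.lt_add_one_iff.2 ((hB' i hi).trans (le_max_left _ _))⟩
  choose h hh using key
  obtain ⟨β, ⟨hβκ, hβS⟩, -, hβ0, hβh⟩ := hS (auxCode θ.ord A) _
    (aux_club κ hκreg hκunc h fun g hg => (hh g hg).1)
  refine ⟨β, ⟨hβκ, hβS, hβ0, ?_⟩, ?_⟩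
  · intro g hg i hi
    obtain ⟨d, hd, hgd, hdb⟩ := (hh g (hg.trans hβκ)).2.2 i hi
    have hlt : θ.ord * d + i < β := hdb.trans (hβh g hg)
    refine ⟨d, hgd, lt_of_le_of_lt ?_ hlt, ?_⟩
    · exact (Ordinal.le_mul_right d (zero_le.trans_lt hi)).trans le_self_add
    · rw [← hβS]
      exact ⟨⟨i, hi, d, hd, rfl⟩, hlt⟩
  · refine hC.2.2 β hβκ hβ0 (aux_sSup_eq (fun _ h => h.2) fun g hg => ?_)
    obtain ⟨c, hc, hgc, hcb⟩ := (hh g (hg.trans hβκ)).2.1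
    exact ⟨c, ⟨hc, hcb.trans (hβh g hg)⟩, hgc⟩

theorem statement14 (θ κ : Cardinal.{0}) (hθreg : θ.IsRegular) (hκreg : κ.IsRegular)
    (hθinf : ℵ₀ ≤ θ) (hθκ : θ < κ) (hκunc : ℵ₀ < κ) (hdia : DiamondP κ) :
    ∃ Φ : Set Ordinal → Set Ordinal, IsPostprocessing κ Φ ∧
      (∀ x ∈ KSet κ, accSet (Φ x) = accSet x) ∧
      ∀ A : Ordinal → Set Ordinal,
        (∀ i < θ.ord, A i ⊆ Set.Iio κ.ord ∧ ∀ β < κ.ord, ∃ γ ∈ A i, β ≤ γ) →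
        ∃ G : Set Ordinal, G ⊆ Set.Iio κ.ord ∧ IsStationaryIn G κ.ord ∧
          ∀ x ∈ KSet κ, sSup (naccSet x ∩ G) = sSup x → (sSup x).cof = θ →
            ∀ i < θ.ord, sSup (naccSet (Φ x) ∩ A i) = sSup x := by
  have ht : θ.ord ≠ 0 := by
    have : θ ≠ 0 := (Cardinal.aleph0_pos.trans_le hθinf).ne'
    simpa using this
  obtain ⟨S, hSsub, hS⟩ := hdia
  refine ⟨auxΦ θ.ord S, auxΦ_post ht S κ, fun x hx => auxΦ_acc ht S hx, fun A hA => ?_⟩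
  refine ⟨{β | β < κ.ord ∧ auxCode θ.ord A ∩ Set.Iio β = S β ∧ auxGood θ.ord S β},
    fun β h => h.1, aux_stat θ κ hκreg hθκ hκunc S hS A hA, ?_⟩
  intro x hx hsup hcof i hi
  set G := {β | β < κ.ord ∧ auxCode θ.ord A ∩ Set.Iio β = S β ∧ auxGood θ.ord S β} with hG
  refine aux_sSup_eq (fun z hz => ((auxΦ_post ht S κ) x hx).1.1 hz.1.1) fun g hg => ?_
  obtain ⟨c, hc, hgc⟩ := auxK_next hx hg
  obtain ⟨b, hbT, hcb, hidx⟩ := auxHit θ hθinf (naccSet x ∩ G) (sSup x) hcof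
    (fun z hz => hx.2.2.1 hz.1.1) (fun g hg => aux_lt_of_sSup hsup hg) i hi c (hx.2.2.1 hc)
  obtain ⟨hbn, hbκ, hbS, hbg⟩ := hbT
  have hlt : sSup (x ∩ Set.Iio b) < b :=
    lt_of_le_of_ne (aux_sSup_Iio_le x b) fun h => hbn.2 ⟨hbn.1, hbg.1, h⟩
  have hrk : auxRk (auxT θ.ord S (x ∩ Set.Iio b) b) b = auxRk (naccSet x ∩ G) b := by
    apply auxRk_congr
    intro e he
    have h1 : S b ∩ Set.Iio e = auxCode θ.ord A ∩ Set.Iio e := by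
      rw [← hbS, Set.inter_assoc, Set.Iio_inter_Iio, min_eq_right he.le]
    simp only [auxT, Set.mem_setOf_eq, aux_nacc_cut x he, h1, hG, Set.mem_inter_iff]
    have := he.trans hbκ
    tauto
  obtain ⟨h1, h2, h3⟩ := auxPhi_spec ht hlt hbg
  rw [hrk, hidx, ← hbS] at h3
  refine ⟨auxPhi θ.ord S (x ∩ Set.Iio b) b, ⟨⟨⟨b, hbn.1, rfl⟩, ?_⟩, auxCode_mem hi h3.1⟩,
    hgc.trans ((aux_le_sSup_Iio hc hcb).trans_lt h1)⟩
  rw [auxΦ_acc ht S hx]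
  intro hacc
  exact absurd (aux_le_sSup_Iio hacc.1 h2) (not_le.2 h1)
end
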